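/- Let p > 1 and let k ∈ C(Ω) be nonnegative, bounded and not identically zero. If μ₁ < μ₂ and u_{μ₁}, u_{μ₂} are positive viscosity solutions of problem (1) with parameters μ₁ and μ₂ respectively, then u_{μ₁} < u_{μ₂} in Ω. -/

import Mathlib

open scoped Matrix Topology
open Bornology MeasureTheory

noncomputable section

/-- Euclidean space `ℝ^N`. -/
abbrev Euc (N : ℕ) := EuclideanSpace ℝ (Fin N)

/-- The Hessian matrix of a (test) function `φ` at `x`, with entries the second
partial derivatives in the coordinate directions. -/
def hessianMatrix {N : ℕ} (φ : Euc N → ℝ) (x : Euc N) : Matrix (Fin N) (Fin N) ℝ :=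
  Matrix.of fun i j =>
    iteratedFDeriv ℝ 2 φ x ![EuclideanSpace.single i (1 : ℝ), EuclideanSpace.single j (1 : ℝ)]

/-- Loewner (partial) order on real square matrices: `A ≤ B` iff `B - A` is positive
semidefinite. -/
def MatLE {n : Type*} [Fintype n] (A B : Matrix n n ℝ) : Prop := (B - A).PosSemidef

/-- `u` is a viscosity subsolution of `G(x, u, D²u) ≥ 0` on `Ω`: at any interior point where a
`C²` function `φ` touches `u` from above, `G(x₀, u(x₀), D²φ(x₀)) ≥ 0`. -/
def ViscSubsol {N : ℕ} (Ω : Set (Euc N))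
    (G : Euc N → ℝ → Matrix (Fin N) (Fin N) ℝ → ℝ) (u : Euc N → ℝ) : Prop :=
  ∀ x₀ ∈ Ω, ∀ φ : Euc N → ℝ, ContDiff ℝ 2 φ → u x₀ = φ x₀ →
    IsLocalMaxOn (fun x => u x - φ x) Ω x₀ →
    0 ≤ G x₀ (u x₀) (hessianMatrix φ x₀)

/-- `u` is a viscosity supersolution of `G(x, u, D²u) ≤ 0` on `Ω`: at any interior point where a
`C²` function `φ` touches `u` from below, `G(x₀, u(x₀), D²φ(x₀)) ≤ 0`. -/
def ViscSupersol {N : ℕ} (Ω : Set (Euc N))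
    (G : Euc N → ℝ → Matrix (Fin N) (Fin N) ℝ → ℝ) (u : Euc N → ℝ) : Prop :=
  ∀ x₀ ∈ Ω, ∀ φ : Euc N → ℝ, ContDiff ℝ 2 φ → u x₀ = φ x₀ →
    IsLocalMinOn (fun x => u x - φ x) Ω x₀ →
    G x₀ (u x₀) (hessianMatrix φ x₀) ≤ 0

/-- (F1): uniform ellipticity with ellipticity constants `0 < lam ≤ Lam`. -/
def IsF1 {N : ℕ} (Ω : Set (Euc N)) (F : Euc N → Matrix (Fin N) (Fin N) ℝ → ℝ)
    (lam Lam : ℝ) : Prop :=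
  0 < lam ∧ lam ≤ Lam ∧
    ∀ x ∈ Ω, ∀ X P : Matrix (Fin N) (Fin N) ℝ, X.IsSymm → P.PosSemidef →
      lam * P.trace ≤ F x (X + P) - F x X ∧ F x (X + P) - F x X ≤ Lam * P.trace

/-- (F2): positive 1-homogeneity in the matrix variable. -/
def IsF2 {N : ℕ} (Ω : Set (Euc N)) (F : Euc N → Matrix (Fin N) (Fin N) ℝ → ℝ) : Prop :=
  ∀ x ∈ Ω, ∀ t : ℝ, 0 ≤ t → ∀ X : Matrix (Fin N) (Fin N) ℝ, F x (t • X) = t * F x X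

/-- (F3): the standard structure condition of viscosity solution theory, with a modulus of
continuity `ω`. -/
def IsF3 {N : ℕ} (Ω : Set (Euc N)) (F : Euc N → Matrix (Fin N) (Fin N) ℝ → ℝ) : Prop :=
  ∃ ω : ℝ → ℝ, Monotone ω ∧ ω 0 = 0 ∧ ContinuousAt ω 0 ∧ (∀ t, 0 ≤ ω t) ∧
    ∀ α : ℝ, 0 < α → ∀ x ∈ Ω, ∀ y ∈ Ω, ∀ X Y : Matrix (Fin N) (Fin N) ℝ,
      X.IsSymm → Y.IsSymm →
      MatLE ((-(3 * α)) • (1 : Matrix (Fin N ⊕ Fin N) (Fin N ⊕ Fin N) ℝ))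
        (Matrix.fromBlocks X 0 0 (-Y)) →
      MatLE (Matrix.fromBlocks X 0 0 (-Y))
        ((3 * α) • Matrix.fromBlocks 1 (-1) (-1) 1) →
      F x X - F y Y ≤ ω (α * ‖x - y‖ ^ 2 + ‖x - y‖)

/-- Continuity of `F` on `Ω × 𝒮_N`. -/
def FCont {N : ℕ} (Ω : Set (Euc N)) (F : Euc N → Matrix (Fin N) (Fin N) ℝ → ℝ) : Prop :=
  ContinuousOn (fun q : Euc N × Matrix (Fin N) (Fin N) ℝ => F q.1 q.2) (Ω ×ˢ Set.univ)

/-- A bounded domain (open, bounded, nonempty, connected set) of class `C²`, described by a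
`C²` defining function with nonvanishing gradient on the boundary. -/
def IsC2Domain {N : ℕ} (Ω : Set (Euc N)) : Prop :=
  IsOpen Ω ∧ IsBounded Ω ∧ Ω.Nonempty ∧ IsConnected Ω ∧
    ∃ f : Euc N → ℝ, ContDiff ℝ 2 f ∧ Ω = {x | f x < 0} ∧
      frontier Ω = {x | f x = 0} ∧ ∀ x ∈ frontier Ω, fderiv ℝ f x ≠ 0

/-- The operator `F(x, M) + μ r` of the eigenvalue problem. -/
def eigenG {N : ℕ} (F : Euc N → Matrix (Fin N) (Fin N) ℝ → ℝ) (μ : ℝ) :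
    Euc N → ℝ → Matrix (Fin N) (Fin N) ℝ → ℝ :=
  fun x r M => F x M + μ * r

/-- The principal eigenvalue (à la Berestycki–Nirenberg–Varadhan) of `F` on `D`:
`λ₁⁺(D) = sup {μ : ∃ ψ > 0 in D, F(x, D²ψ) + μψ ≤ 0 in D in the viscosity sense}`. -/
def principalEigenvalue {N : ℕ} (F : Euc N → Matrix (Fin N) (Fin N) ℝ → ℝ)
    (D : Set (Euc N)) : ℝ :=
  sSup {μ : ℝ | ∃ ψ : Euc N → ℝ, (∀ x ∈ D, 0 < ψ x) ∧ ViscSupersol D (eigenG F μ) ψ}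

/-- The logistic operator `F(x, M) + μ r - k(x) r^p`. -/
def logisticG {N : ℕ} (F : Euc N → Matrix (Fin N) (Fin N) ℝ → ℝ) (μ : ℝ)
    (k : Euc N → ℝ) (p : ℝ) : Euc N → ℝ → Matrix (Fin N) (Fin N) ℝ → ℝ :=
  fun x r M => F x M + μ * r - k x * Real.rpow r p

/-- `u` is a (positive, viscosity) solution of problem (1):
`F(x,D²u) + μ u = k(x) u^p` in `Ω`, `u > 0` in `Ω`, `u = 0` on `∂Ω`. -/
def IsSolP1 {N : ℕ} (Ω : Set (Euc N)) (F : Euc N → Matrix (Fin N) (Fin N) ℝ → ℝ)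
    (μ : ℝ) (k : Euc N → ℝ) (p : ℝ) (u : Euc N → ℝ) : Prop :=
  ContinuousOn u (closure Ω) ∧ (∀ x ∈ Ω, 0 < u x) ∧
    ViscSubsol Ω (logisticG F μ k p) u ∧ ViscSupersol Ω (logisticG F μ k p) u ∧
    ∀ x ∈ frontier Ω, u x = 0

/-- Condition (K1): `k` is bounded below by a positive constant on `Ω`. -/
def CondK1 {N : ℕ} (Ω : Set (Euc N)) (k : Euc N → ℝ) : Prop :=
  ∃ k₀ : ℝ, 0 < k₀ ∧ ∀ x ∈ Ω, k₀ ≤ k x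

/-- Condition (K2), with the vanishing subdomain `Ω₀` explicit: `Ω₀` is a `C²` bounded domain
compactly contained in `Ω`, `k = 0` on `closure Ω₀`, and `inf_{Ω \ Ω₁} k > 0` for every open
`Ω₁ ⊊ Ω` compactly containing `Ω₀`. -/
def CondK2 {N : ℕ} (Ω Ω₀ : Set (Euc N)) (k : Euc N → ℝ) : Prop :=
  IsC2Domain Ω₀ ∧ closure Ω₀ ⊆ Ω ∧ (∀ x ∈ closure Ω₀, k x = 0) ∧
    ∀ Ω₁ : Set (Euc N), IsOpen Ω₁ → Ω₁ ⊆ Ω → Ω₁ ≠ Ω → closure Ω₀ ⊆ Ω₁ →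
      ∃ c : ℝ, 0 < c ∧ ∀ x ∈ Ω \ Ω₁, c ≤ k x

/-- The sup norm `‖u‖_{L^∞(S)}`. -/
def supNorm {N : ℕ} (S : Set (Euc N)) (u : Euc N → ℝ) : ℝ := sSup (u '' S)

/-- The Pucci maximal operator `𝓜⁺_{lam,Lam}(M) = sup {tr(A M) : lam I ≤ A ≤ Lam I}`. -/
def pucciSup {N : ℕ} (lam Lam : ℝ) (M : Matrix (Fin N) (Fin N) ℝ) : ℝ :=
  sSup {t : ℝ | ∃ A : Matrix (Fin N) (Fin N) ℝ, A.IsSymm ∧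
    MatLE (lam • (1 : Matrix (Fin N) (Fin N) ℝ)) A ∧
    MatLE A (Lam • (1 : Matrix (Fin N) (Fin N) ℝ)) ∧ t = (A * M).trace}

/-- Solution of the blow-up problem on the annulus `Ω \ closure Ω₀`:
`F(x,D²u) + μ u = k(x) u^p` and `u > 0` in `Ω \ closure Ω₀`, `u = 0` on `∂Ω`,
`u(x) → +∞` as `x → ∂Ω₀`. -/
def IsSolBlowUp {N : ℕ} (Ω Ω₀ : Set (Euc N)) (F : Euc N → Matrix (Fin N) (Fin N) ℝ → ℝ)
    (μ : ℝ) (k : Euc N → ℝ) (p : ℝ) (u : Euc N → ℝ) : Prop :=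
  ContinuousOn u (closure Ω \ closure Ω₀) ∧ (∀ x ∈ Ω \ closure Ω₀, 0 < u x) ∧
    ViscSubsol (Ω \ closure Ω₀) (logisticG F μ k p) u ∧
    ViscSupersol (Ω \ closure Ω₀) (logisticG F μ k p) u ∧
    (∀ x ∈ frontier Ω, u x = 0) ∧
    ∀ M : ℝ, ∃ δ : ℝ, 0 < δ ∧
      ∀ x ∈ Ω \ closure Ω₀, Metric.infDist x (frontier Ω₀) < δ → M ≤ u x

/-- Solution of the Dirichlet problem on the annulus `Ω \ closure Ω₀` with boundary data `0`
on `∂Ω` and `φb` on `∂Ω₀`. -/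
def IsSolAnnulus {N : ℕ} (Ω Ω₀ : Set (Euc N)) (F : Euc N → Matrix (Fin N) (Fin N) ℝ → ℝ)
    (μ : ℝ) (k : Euc N → ℝ) (p : ℝ) (φb : Euc N → ℝ) (u : Euc N → ℝ) : Prop :=
  ContinuousOn u (closure (Ω \ closure Ω₀)) ∧ (∀ x ∈ Ω \ closure Ω₀, 0 < u x) ∧
    ViscSubsol (Ω \ closure Ω₀) (logisticG F μ k p) u ∧
    ViscSupersol (Ω \ closure Ω₀) (logisticG F μ k p) u ∧
    (∀ x ∈ frontier Ω, u x = 0) ∧ ∀ x ∈ frontier Ω₀, u x = φb x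

section JensenAlexandrov

variable {V : Type*} [NormedAddCommGroup V] [InnerProductSpace ℝ V]

open scoped Pointwise in
/-- At a point of Lebesgue density one, a set meets every ball of radius proportional to the
distance of its centre to that point. -/
theorem exists_mem_near_of_density_one [FiniteDimensional ℝ V] [MeasurableSpace V] [BorelSpace V] (m : Measure V)
    [m.IsAddHaarMeasure] {K : Set V} {x : V}
    (hx : Filter.Tendsto (fun r => m (K ∩ Metric.closedBall x r) / m (Metric.closedBall x r))
      (𝓝[>] 0) (𝓝 1)) (hxK : x ∈ K) {ε : ℝ} (hε : 0 < ε) :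
    ∃ r > 0, ∀ v : V, ‖v‖ < r → ∃ y ∈ K, ‖y - (x + v)‖ ≤ ε * ‖v‖ := by
  obtain ⟨t, -, htf, htc⟩ := (isCompact_sphere (0 : V) 1).finite_cover_balls (half_pos hε)
  have h : ∀ᶠ r in 𝓝[>] (0 : ℝ), ∀ e ∈ t, (K ∩ ({x} + r • Metric.ball e (ε / 2))).Nonempty := by
    rw [Filter.eventually_all_finite htf]
    intro e _
    exact Measure.eventually_nonempty_inter_smul_of_density_one m K x hx _
      measurableSet_ball (Metric.measure_ball_pos m e (half_pos hε)).ne'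
  obtain ⟨r, hr, hrs⟩ := mem_nhdsGT_iff_exists_Ioo_subset.1 h
  refine ⟨r, hr, fun v hv => ?_⟩
  rcases eq_or_ne v 0 with rfl | hv0
  · exact ⟨x, hxK, by simp⟩
  have hn : 0 < ‖v‖ := norm_pos_iff.2 hv0
  have hmem : ‖v‖⁻¹ • v ∈ Metric.sphere (0 : V) 1 := by
    simp [norm_smul, hn.ne']
  obtain ⟨e, he, hve⟩ := Set.mem_iUnion₂.1 (htc hmem)
  obtain ⟨y, hyK, hy⟩ := hrs (show ‖v‖ ∈ Set.Ioo 0 r from ⟨hn, hv⟩) e he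
  obtain ⟨x', hx', z, hz, rfl⟩ := Set.mem_add.1 hy
  obtain rfl : x' = x := hx'
  obtain ⟨b, hb, rfl⟩ := Set.mem_smul_set.1 hz
  refine ⟨_, hyK, ?_⟩
  have h1 : ‖b - ‖v‖⁻¹ • v‖ ≤ ε := by
    rw [← dist_eq_norm]
    have := dist_triangle_right b (‖v‖⁻¹ • v) e
    rw [Metric.mem_ball] at hb hve
    linarith
  have h2 : x' + ‖v‖ • b - (x' + v) = ‖v‖ • (b - ‖v‖⁻¹ • v) := by
    rw [smul_sub, smul_inv_smul₀ hn.ne']; abel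
  rw [h2, norm_smul, norm_norm, mul_comm]
  gcongr

/-- A map that is Lipschitz on a non-null set has, at some point of that set, an approximate
derivative in the sense of a first order expansion along the set. -/
theorem exists_approx_fderiv [FiniteDimensional ℝ V] [MeasurableSpace V] [BorelSpace V] (m : Measure V)
    [m.IsAddHaarMeasure] {K : Set V} {Z : V → V} {L : NNReal} (hZ : LipschitzOnWith L Z K)
    (hK : m K ≠ 0) :
    ∃ x ∈ K, ∃ B : V →L[ℝ] V, ∀ ε > 0, ∃ r > 0, ∀ v : V, ‖v‖ < r →
      ∃ y ∈ K, ‖y - (x + v)‖ ≤ ε * ‖v‖ ∧ ‖Z y - Z x - B v‖ ≤ ε * ‖v‖ := by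
  obtain ⟨Z', hZ', hEq⟩ := hZ.extend_finite_dimension
  have h1 := Besicovitch.ae_tendsto_measure_inter_div m K
  have h2 : ∀ᵐ x ∂(m.restrict K), DifferentiableAt ℝ Z' x :=
    ae_restrict_of_ae hZ'.ae_differentiableAt
  have h3 := h1.and h2
  obtain ⟨x, hxK, hxd, hxf⟩ : ∃ x ∈ K, Filter.Tendsto
      (fun r => m (K ∩ Metric.closedBall x r) / m (Metric.closedBall x r)) (𝓝[>] 0) (𝓝 1) ∧
      DifferentiableAt ℝ Z' x := by
    by_contra! hcon
    apply hK
    have h4 := Measure.le_restrict_apply (μ := m) K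
      {x | ¬ (Filter.Tendsto (fun r => m (K ∩ Metric.closedBall x r) /
        m (Metric.closedBall x r)) (𝓝[>] 0) (𝓝 1) ∧ DifferentiableAt ℝ Z' x)}
    rw [ae_iff.1 h3] at h4
    refine measure_mono_null (fun x hx => ?_) (le_antisymm h4 bot_le)
    exact ⟨fun h => hcon x hx h.1 h.2, hx⟩
  refine ⟨x, hxK, fderiv ℝ Z' x, fun ε hε => ?_⟩
  set B := fderiv ℝ Z' x
  set ε' : ℝ := min 1 (ε / (2 + ‖B‖)) with hε'
  have hB : 0 < 2 + ‖B‖ := by positivity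
  have hε'0 : 0 < ε' := lt_min one_pos (div_pos hε hB)
  have hε'1 : ε' ≤ 1 := min_le_left _ _
  have hε'2 : ε' * (2 + ‖B‖) ≤ ε := (le_div_iff₀ hB).1 (min_le_right _ _)
  obtain ⟨r₁, hr₁, H₁⟩ := exists_mem_near_of_density_one m hxd hxK hε'0
  have h5 := (hasFDerivAt_iff_isLittleO_nhds_zero.1 hxf.hasFDerivAt).def hε'0
  obtain ⟨r₂, hr₂, H₂⟩ := Metric.eventually_nhds_iff.1 h5
  refine ⟨min r₁ (r₂ / 2), lt_min hr₁ (half_pos hr₂), fun v hv => ?_⟩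
  obtain ⟨y, hyK, hy⟩ := H₁ v (hv.trans_le (min_le_left _ _))
  have hv2 : ‖v‖ < r₂ / 2 := hv.trans_le (min_le_right _ _)
  have hn := norm_nonneg v
  have hBn := norm_nonneg B
  have hyx : ‖y - x‖ ≤ (1 + ε') * ‖v‖ := by
    calc ‖y - x‖ = ‖(y - (x + v)) + v‖ := by congr 1; abel
      _ ≤ ‖y - (x + v)‖ + ‖v‖ := norm_add_le _ _
      _ ≤ _ := by linarith
  have hyx2 : ‖y - x‖ ≤ 2 * ‖v‖ := by nlinarith
  refine ⟨y, hyK, hy.trans ?_, ?_⟩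
  · gcongr
    nlinarith
  · have h6 := H₂ (y := y - x) (by rw [dist_zero_right]; linarith)
    rw [add_sub_cancel, hEq.symm hyK, hEq.symm hxK] at h6
    have h7 : ‖B (y - (x + v))‖ ≤ ‖B‖ * (ε' * ‖v‖) :=
      (B.le_opNorm _).trans (by gcongr)
    calc ‖Z y - Z x - B v‖ = ‖(Z y - Z x - B (y - x)) + B (y - (x + v))‖ := by
          congr 1; simp only [map_sub, map_add]; abel
      _ ≤ ε' * (2 * ‖v‖) + ‖B‖ * (ε' * ‖v‖) := by
          refine (norm_add_le _ _).trans (add_le_add (h6.trans (by gcongr)) h7)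
      _ = ε' * (2 + ‖B‖) * ‖v‖ := by ring
      _ ≤ ε * ‖v‖ := by gcongr

/-- A function on `[0, 1]` whose increments are bounded by `E |t - s| + C |t - s|²` has total
increment at most `E`. -/
theorem abs_sub_le_of_increment_le {h : ℝ → ℝ} {E C : ℝ}
    (hh : ∀ s ∈ Set.Icc (0 : ℝ) 1, ∀ t ∈ Set.Icc (0 : ℝ) 1,
      |h t - h s| ≤ E * |t - s| + C * |t - s| ^ 2) : |h 1 - h 0| ≤ E := by
  have key : ∀ n : ℕ, |h 1 - h 0| ≤ E + C * (1 / ((n : ℝ) + 1)) := by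
    intro n
    have hn : (0 : ℝ) < n + 1 := by positivity
    have hs : ∀ j : ℕ, j ≤ n + 1 → |h (j / (n + 1)) - h 0| ≤
        j * (E * (1 / (n + 1)) + C * (1 / (n + 1)) ^ 2) := by
      intro j
      induction j with
      | zero => intro _; simp
      | succ j ih =>
        intro hj
        have h1 := ih (by omega)
        have hj' : (j : ℝ) + 1 ≤ n + 1 := by exact_mod_cast hj
        have h2 := hh (j / (n + 1)) ⟨by positivity, by rw [div_le_one hn]; linarith⟩
          (((j + 1 : ℕ) : ℝ) / (n + 1)) ⟨by positivity, by
            rw [div_le_one hn]; push_cast; linarith⟩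
        have h3 : ((j + 1 : ℕ) : ℝ) / (n + 1) - j / (n + 1) = 1 / (n + 1) := by
          push_cast; ring
        rw [h3, abs_of_pos (show (0 : ℝ) < 1 / (n + 1) by positivity)] at h2
        have h4 := abs_sub_le (h (((j + 1 : ℕ) : ℝ) / (n + 1))) (h (j / (n + 1))) (h 0)
        push_cast at *
        linarith
    have := hs (n + 1) le_rfl
    push_cast at this
    rw [div_self hn.ne'] at this
    refine this.trans (le_of_eq ?_)
    field_simp
  have hlim : Filter.Tendsto (fun n : ℕ => E + C * (1 / ((n : ℝ) + 1))) Filter.atTop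
      (𝓝 (E + C * 0)) :=
    (tendsto_one_div_add_atTop_nhds_zero_nat.const_mul C).const_add E
  simpa using ge_of_tendsto' hlim key

/-- Existence of a maximiser of the doubled functional, perturbed by a linear term. -/
theorem exists_isMax_doubled [FiniteDimensional ℝ V] {S : Set V} (hS : IsCompact S) (hSn : S.Nonempty) {g : V → ℝ}
    (hg : ContinuousOn g S) {Q : V →L[ℝ] V} (hQ1 : ∀ x, ‖x‖ ^ 2 ≤ inner ℝ (Q x) x) (p : V) :
    ∃ z ∈ S, ∃ ζ, ∀ z' ∈ S, ∀ ζ',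
      g z' + inner ℝ z' ζ' - 1 / 2 * inner ℝ (Q ζ') ζ' - inner ℝ p ζ' ≤
      g z + inner ℝ z ζ - 1 / 2 * inner ℝ (Q ζ) ζ - inner ℝ p ζ := by
  obtain ⟨D, hD⟩ := hS.isBounded.exists_norm_le
  set R := 2 * (|D| + ‖p‖) with hR
  have hR0 : 0 ≤ R := by positivity
  let f : V × V → ℝ := fun q =>
    g q.1 + inner ℝ q.1 q.2 - 1 / 2 * inner ℝ (Q q.2) q.2 - inner ℝ p q.2
  have hf : ContinuousOn f (S ×ˢ Metric.closedBall (0 : V) R) := by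
    have h1 : ContinuousOn (fun q : V × V => g q.1) (S ×ˢ Metric.closedBall (0 : V) R) :=
      hg.comp continuousOn_fst fun q hq => hq.1
    have h2 : Continuous (fun q : V × V => inner ℝ q.1 q.2) := by fun_prop
    have h3 : Continuous (fun q : V × V => 1 / 2 * inner ℝ (Q q.2) q.2) := by fun_prop
    have h4 : Continuous (fun q : V × V => inner ℝ p q.2) := by fun_prop
    exact ((h1.add h2.continuousOn).sub h3.continuousOn).sub h4.continuousOn
  obtain ⟨⟨z, ζ⟩, ⟨hz, hζ⟩, hmax⟩ :=
    (hS.prod (isCompact_closedBall (0 : V) R)).exists_isMaxOn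
      (hSn.prod ⟨0, Metric.mem_closedBall_self hR0⟩) hf
  refine ⟨z, hz, ζ, fun z' hz' ζ' => ?_⟩
  by_cases hζ' : ‖ζ'‖ ≤ R
  · exact hmax (show (z', ζ') ∈ S ×ˢ Metric.closedBall (0 : V) R from
      ⟨hz', by simpa using hζ'⟩)
  · push Not at hζ'
    have h0 := hmax (show (z', (0 : V)) ∈ S ×ˢ Metric.closedBall (0 : V) R from
      ⟨hz', Metric.mem_closedBall_self hR0⟩)
    simp only [Set.mem_ofPred_eq, f, inner_zero_right, map_zero] at h0
    have h1 : inner ℝ z' ζ' ≤ |D| * ‖ζ'‖ :=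
      (real_inner_le_norm _ _).trans
        (by gcongr; exact (hD z' hz').trans (le_abs_self D))
    have h2 : -(‖p‖ * ‖ζ'‖) ≤ inner ℝ p ζ' := neg_le_of_abs_le (abs_real_inner_le_norm _ _)
    have h3 := hQ1 ζ'
    nlinarith [norm_nonneg ζ']

section Contact

variable {S : Set V} {g : V → ℝ} {Q : V →L[ℝ] V}

theorem sub_eq_of_isMax_doubled (hQs : ∀ x y, inner ℝ (Q x) y = inner ℝ x (Q y))
    (hQ3 : ∀ x, inner ℝ (Q x) x ≤ 3 * ‖x‖ ^ 2) {p z ζ : V} (hz : z ∈ S)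
    (hmax : ∀ z' ∈ S, ∀ ζ',
      g z' + inner ℝ z' ζ' - 1 / 2 * inner ℝ (Q ζ') ζ' - inner ℝ p ζ' ≤
      g z + inner ℝ z ζ - 1 / 2 * inner ℝ (Q ζ) ζ - inner ℝ p ζ) :
    z - Q ζ = p := by
  set r := z - Q ζ - p with hr
  have h1 := hmax z hz (ζ + (1 / 3 : ℝ) • r)
  have h2 := hQ3 r
  have h3 : inner ℝ z r - inner ℝ (Q ζ) r - inner ℝ p r = ‖r‖ ^ 2 := by
    rw [← inner_sub_left, ← inner_sub_left, ← hr, real_inner_self_eq_norm_sq]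
  simp only [map_add, map_smul, inner_add_left, inner_add_right, real_inner_smul_left,
    real_inner_smul_right] at h1
  have h4 : inner ℝ (Q r) ζ = inner ℝ (Q ζ) r := by rw [hQs, real_inner_comm]
  rw [h4] at h1
  have h5 : ‖r‖ ^ 2 ≤ 0 := by linarith
  have h6 : r = 0 := by
    have := sq_nonneg ‖r‖
    exact norm_eq_zero.1 (pow_eq_zero_iff (two_ne_zero) |>.1 (le_antisymm h5 this))
  exact sub_eq_zero.1 h6

theorem norm_sq_le_of_isMax_doubled (hQs : ∀ x y, inner ℝ (Q x) y = inner ℝ x (Q y))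
    (hQ3 : ∀ x, inner ℝ (Q x) x ≤ 3 * ‖x‖ ^ 2) {p z ζ : V} (hz : z ∈ S)
    (hmax : ∀ z' ∈ S, ∀ ζ',
      g z' + inner ℝ z' ζ' - 1 / 2 * inner ℝ (Q ζ') ζ' - inner ℝ p ζ' ≤
      g z + inner ℝ z ζ - 1 / 2 * inner ℝ (Q ζ) ζ - inner ℝ p ζ) {y : V} (hy : y ∈ S) :
    1 / 6 * ‖y - z‖ ^ 2 ≤ g z + inner ℝ z ζ - g y - inner ℝ y ζ := by
  have hp := sub_eq_of_isMax_doubled hQs hQ3 hz hmax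
  have h1 := hmax y hy (ζ + (1 / 3 : ℝ) • (y - z))
  have h2 := hQ3 (y - z)
  have h4 : inner ℝ (Q (y - z)) ζ = inner ℝ (Q ζ) (y - z) := by rw [hQs, real_inner_comm]
  have h3 : inner ℝ p (y - z) = inner ℝ z (y - z) - inner ℝ (Q ζ) (y - z) := by
    rw [← hp, inner_sub_left]
  have h5 : inner ℝ y (y - z) - inner ℝ z (y - z) = ‖y - z‖ ^ 2 := by
    rw [← inner_sub_left, real_inner_self_eq_norm_sq]
  have h6 : Q (ζ + (1 / 3 : ℝ) • (y - z)) = Q ζ + (1 / 3 : ℝ) • Q (y - z) := by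
    rw [Q.map_add, Q.map_smul]
  rw [h6] at h1
  simp only [inner_add_left, inner_add_right, real_inner_smul_left,
    real_inner_smul_right] at h1
  rw [h4, h3] at h1
  linarith

end Contact

theorem norm_le_mul_of_sq_le_inner {x y : V} {C : ℝ} (hC : 0 < C)
    (h : 1 / C * ‖x‖ ^ 2 ≤ inner ℝ x y) : ‖x‖ ≤ C * ‖y‖ := by
  have h1 := h.trans (real_inner_le_norm x y)
  rcases eq_or_lt_of_le (norm_nonneg x) with h0 | h0
  · rw [← h0]; positivity
  · rw [one_div, inv_mul_le_iff₀ hC] at h1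
    nlinarith

/-- A quantitative combination of the lemmas of Jensen and Alexandrov: the convex function
`G ζ = sup_{z ∈ S} (g z + ⟪z, ζ⟫)`, minus a quadratic form and a small linear perturbation, has
a maximum at a point where `G` has a second order expansion. -/
theorem exists_isMax_second_order_expansion [FiniteDimensional ℝ V] {S : Set V} (hS : IsCompact S) (hSn : S.Nonempty)
    {g : V → ℝ} (hg : ContinuousOn g S) {Q : V →L[ℝ] V}
    (hQs : ∀ x y, inner ℝ (Q x) y = inner ℝ x (Q y))
    (hQ1 : ∀ x, ‖x‖ ^ 2 ≤ inner ℝ (Q x) x) (hQ3 : ∀ x, inner ℝ (Q x) x ≤ 3 * ‖x‖ ^ 2)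
    {G : V → ℝ} (hG1 : ∀ ζ, ∀ z ∈ S, g z + inner ℝ z ζ ≤ G ζ)
    (hG2 : ∀ ζ, ∃ z ∈ S, g z + inner ℝ z ζ = G ζ) {δ : ℝ} (hδ : 0 < δ) :
    ∃ z ∈ S, ∃ ζ, ‖z - Q ζ‖ < δ ∧ g z + inner ℝ z ζ = G ζ ∧
      (∀ ζ', G ζ' - 1 / 2 * inner ℝ (Q ζ') ζ' - inner ℝ (z - Q ζ) ζ' ≤
        G ζ - 1 / 2 * inner ℝ (Q ζ) ζ - inner ℝ (z - Q ζ) ζ) ∧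
      ∃ B : V →L[ℝ] V, ∀ ε > 0, ∃ r > 0, ∀ v, ‖v‖ < r →
        |G (ζ + v) - G ζ - inner ℝ z v - 1 / 2 * inner ℝ (B v) v| ≤ ε * ‖v‖ ^ 2 := by
  let _ : MeasurableSpace V := borel V
  have : BorelSpace V := ⟨rfl⟩
  choose zf hzS ζf hmax using fun p => exists_isMax_doubled hS hSn hg hQ1 p
  set K : Set V := ζf '' Metric.ball 0 δ with hK
  have hinv : ∀ ζ : V, ∃ p, ζ ∈ K → p ∈ Metric.ball (0 : V) δ ∧ ζf p = ζ := by
    intro ζ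
    by_cases h : ζ ∈ K
    · obtain ⟨p, hp, hpζ⟩ := h
      exact ⟨p, fun _ => ⟨hp, hpζ⟩⟩
    · exact ⟨0, fun h' => absurd h' h⟩
  choose P hP using hinv
  have hfo := fun p => sub_eq_of_isMax_doubled hQs hQ3 (hzS p) (hmax p)
  have hquad := fun p {y} (hy : y ∈ S) => norm_sq_le_of_isMax_doubled hQs hQ3 (hzS p) (hmax p) hy
  have hlip : ∀ p q, ‖zf p - zf q‖ ≤ 3 * ‖ζf p - ζf q‖ := by
    intro p q
    apply norm_le_mul_of_sq_le_inner (by norm_num)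
    have h1 := hquad p (hzS q)
    have h2 := hquad q (hzS p)
    rw [norm_sub_rev] at h1
    simp only [inner_sub_left, inner_sub_right]
    linarith
  have hlip' : ∀ p ζ y, y ∈ S → g y + inner ℝ y ζ = G ζ → ‖y - zf p‖ ≤ 6 * ‖ζ - ζf p‖ := by
    intro p ζ y hy hyG
    apply norm_le_mul_of_sq_le_inner (by norm_num)
    have h1 := hquad p hy
    have h2 := hG1 ζ _ (hzS p)
    simp only [inner_sub_left, inner_sub_right]
    linarith
  set Z : V → V := fun ζ => zf (P ζ) with hZ
  have hZlip : LipschitzOnWith 3 Z K := by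
    refine LipschitzOnWith.of_dist_le_mul fun x hx y hy => ?_
    have := hlip (P x) (P y)
    rw [(hP x hx).2, (hP y hy).2] at this
    simpa [dist_eq_norm] using this
  set m : Measure V := Measure.hausdorffMeasure (Module.finrank ℝ V) with hm
  have : m.IsAddHaarMeasure := isAddHaarMeasure_hausdorffMeasure
  have hKm : m K ≠ 0 := by
    intro h0
    have hPl : LipschitzOnWith (3 + ‖Q‖₊) (fun ζ => Z ζ - Q ζ) K :=
      hZlip.sub (Q.lipschitz.lipschitzOnWith)
    have h1 := hPl.hausdorffMeasure_image_le (d := Module.finrank ℝ V) (by positivity)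
    rw [← hm, h0, mul_zero] at h1
    have h2 : Metric.ball (0 : V) δ ⊆ (fun ζ => Z ζ - Q ζ) '' K := by
      intro p hp
      have hpK : ζf p ∈ K := ⟨p, hp, rfl⟩
      refine ⟨ζf p, hpK, ?_⟩
      have h3 := hlip (P (ζf p)) p
      rw [(hP _ hpK).2, sub_self, norm_zero, mul_zero] at h3
      have h4 : Z (ζf p) = zf p := sub_eq_zero.1 (norm_le_zero_iff.1 h3)
      simp only [h4, hfo p]
    exact (Metric.measure_ball_pos m (0 : V) hδ).ne' (measure_mono_null h2 (le_antisymm h1 bot_le))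
  obtain ⟨ζ, hζK, B, hB⟩ := exists_approx_fderiv m hZlip hKm
  have hζP := hP ζ hζK
  set p := P ζ
  have hp : Z ζ - Q ζ = p := by
    have := hfo p
    rwa [hζP.2] at this
  have hGζ : g (Z ζ) + inner ℝ (Z ζ) ζ = G ζ := by
    obtain ⟨y, hy, hyG⟩ := hG2 ζ
    have h1 := hmax p y hy ζ
    rw [hζP.2] at h1
    have h2 := hG1 ζ _ (hzS p)
    change g (zf p) + inner ℝ (zf p) ζ = G ζ
    linarith
  refine ⟨Z ζ, hzS p, ζ, ?_, hGζ, ?_, B, ?_⟩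
  · rw [hp]; simpa using hζP.1
  · intro ζ'
    obtain ⟨y, hy, hyG⟩ := hG2 ζ'
    have h1 := hmax p y hy ζ'
    rw [hζP.2] at h1
    rw [hp, ← hGζ, ← hyG]
    exact h1
  · have hgrad : ∀ ε > 0, ∃ r > 0, ∀ v, ‖v‖ < r → ∀ y ∈ S,
        g y + inner ℝ y (ζ + v) = G (ζ + v) → ‖y - Z ζ - B v‖ ≤ ε * ‖v‖ := by
      intro ε hε
      obtain ⟨r, hr, H⟩ := hB (ε / 7) (by positivity)
      refine ⟨r, hr, fun v hv y hy hyG => ?_⟩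
      obtain ⟨ζ₁, hζ₁, h1, h2⟩ := H v hv
      have h3 := hlip' (P ζ₁) (ζ + v) y hy hyG
      rw [(hP ζ₁ hζ₁).2, norm_sub_rev (ζ + v)] at h3
      calc ‖y - Z ζ - B v‖ = ‖(y - Z ζ₁) + (Z ζ₁ - Z ζ - B v)‖ := by congr 1; abel
        _ ≤ ‖y - Z ζ₁‖ + ‖Z ζ₁ - Z ζ - B v‖ := norm_add_le _ _
        _ ≤ 6 * ‖ζ₁ - (ζ + v)‖ + ε / 7 * ‖v‖ := add_le_add h3 h2
        _ ≤ ε * ‖v‖ := by linarith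
    intro ε hε
    obtain ⟨r, hr, H⟩ := hgrad ε hε
    refine ⟨r, hr, fun v hv => ?_⟩
    let h : ℝ → ℝ := fun t => G (ζ + t • v) - inner ℝ (Z ζ) v * t - 1 / 2 * inner ℝ (B v) v * t ^ 2
    have hstep : ∀ s ∈ Set.Icc (0 : ℝ) 1, ∀ t ∈ Set.Icc (0 : ℝ) 1,
        h s - h t ≤ ε * ‖v‖ ^ 2 * |t - s| + |inner ℝ (B v) v| * |t - s| ^ 2 := by
      intro s hs t ht
      obtain ⟨y, hy, hyG⟩ := hG2 (ζ + s • v)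
      have hsv : ‖s • v‖ ≤ ‖v‖ := by
        rw [norm_smul, Real.norm_eq_abs, abs_of_nonneg hs.1]
        exact mul_le_of_le_one_left (norm_nonneg v) hs.2
      have h1 := (H (s • v) (hsv.trans_lt hv) y hy hyG).trans
        (mul_le_mul_of_nonneg_left hsv hε.le)
      have h2 : |inner ℝ (y - Z ζ - B (s • v)) v| ≤ ε * ‖v‖ ^ 2 :=
        (abs_real_inner_le_norm _ _).trans (by
          rw [pow_two, ← mul_assoc]; gcongr)
      have h3 := hG1 (ζ + t • v) y hy
      simp only [map_smul, inner_sub_left, real_inner_smul_left] at h2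
      simp only [inner_add_right, real_inner_smul_right] at h3 hyG
      have h4 : (s - t) * (inner ℝ y v - inner ℝ (Z ζ) v - s * inner ℝ (B v) v) ≤
          ε * ‖v‖ ^ 2 * |t - s| := by
        refine (le_abs_self _).trans ?_
        rw [abs_mul, abs_sub_comm s t, mul_comm]
        gcongr
      have h5 : (s - t) ^ 2 * (1 / 2 * inner ℝ (B v) v) ≤
          |inner ℝ (B v) v| * |t - s| ^ 2 := by
        rw [sq_abs]
        have := le_abs_self (inner ℝ (B v) v)
        have := abs_nonneg (inner ℝ (B v) v)
        nlinarith [sq_nonneg (t - s)]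
      simp only [h]
      nlinarith
    have hfin := abs_sub_le_of_increment_le (h := h) (E := ε * ‖v‖ ^ 2)
      (C := |inner ℝ (B v) v|) (fun s hs t ht => by
        rw [abs_le]
        have h1 := hstep s hs t ht
        have h2 := hstep t ht s hs
        rw [abs_sub_comm s t] at h2
        constructor <;> linarith)
    have h01 : h 1 - h 0 =
        G (ζ + v) - G ζ - inner ℝ (Z ζ) v - 1 / 2 * inner ℝ (B v) v := by
      simp only [h, one_smul, zero_smul, add_zero]; ring
    rwa [h01] at hfin

end JensenAlexandrov

section Sums

theorem nonpos_of_forall_small_sq {q k : ℝ}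
    (h : ∀ ε > 0, ∃ t > 0, t ^ 2 * q ≤ ε * (t ^ 2 * k)) : q ≤ 0 := by
  by_contra! hq
  obtain ⟨t, ht, h1⟩ := h (q / (2 * (|k| + 1))) (by positivity)
  have ht2 : 0 < t ^ 2 := by positivity
  have h2 : q ≤ q / (2 * (|k| + 1)) * k := by
    rw [mul_left_comm] at h1
    exact le_of_mul_le_mul_left h1 ht2
  have h3 : q / (2 * (|k| + 1)) * k ≤ q / 2 := by
    rw [div_mul_eq_mul_div, div_le_div_iff₀ (by positivity) (by positivity)]
    nlinarith [le_abs_self k]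
  linarith

variable {E : Type*} [NormedAddCommGroup E] [InnerProductSpace ℝ E]

/-- The quadratic form `|ξ|² + |η|² + |ξ - η|²` on the Hilbert sum, as an operator. -/
def doublingOp (E : Type*) [NormedAddCommGroup E] [InnerProductSpace ℝ E] :
    WithLp 2 (E × E) →L[ℝ] WithLp 2 (E × E) :=
  (WithLp.prodContinuousLinearEquiv 2 ℝ E E).symm.toContinuousLinearMap ∘L
    (((2 : ℝ) • ContinuousLinearMap.fst ℝ E E - ContinuousLinearMap.snd ℝ E E).prod
      ((2 : ℝ) • ContinuousLinearMap.snd ℝ E E - ContinuousLinearMap.fst ℝ E E)) ∘L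
    (WithLp.prodContinuousLinearEquiv 2 ℝ E E).toContinuousLinearMap

theorem inner_doublingOp (x y : WithLp 2 (E × E)) :
    inner ℝ (doublingOp E x) y = 2 * inner ℝ x.fst y.fst - inner ℝ x.snd y.fst +
      (2 * inner ℝ x.snd y.snd - inner ℝ x.fst y.snd) := by
  simp [doublingOp, WithLp.prod_inner_apply, inner_sub_left, real_inner_smul_left]

theorem exists_sup_convolution {C : Set E} (hC : IsCompact C) (hCn : C.Nonempty) {a : E → ℝ}
    (ha : ContinuousOn a C) :
    ∃ G : E → ℝ, (∀ ξ, ∀ x ∈ C, a x - 1 / 2 * ‖x‖ ^ 2 + inner ℝ x ξ ≤ G ξ) ∧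
      ∀ ξ, ∃ x ∈ C, a x - 1 / 2 * ‖x‖ ^ 2 + inner ℝ x ξ = G ξ := by
  have h : ∀ ξ, ∃ x ∈ C, IsMaxOn (fun x => a x - 1 / 2 * ‖x‖ ^ 2 + inner ℝ x ξ) C x := by
    intro ξ
    refine hC.exists_isMaxOn hCn ((ha.sub ?_).add ?_) <;> fun_prop
  choose x hx hmax using h
  exact ⟨fun ξ => a (x ξ) - 1 / 2 * ‖x ξ‖ ^ 2 + inner ℝ (x ξ) ξ, fun ξ y hy => hmax ξ hy,
    fun ξ => ⟨x ξ, hx ξ, rfl⟩⟩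

theorem le_of_sup_convolution_expansion {C : Set E} {a G : E → ℝ}
    (hG : ∀ ξ, ∀ x ∈ C, a x - 1 / 2 * ‖x‖ ^ 2 + inner ℝ x ξ ≤ G ξ) {x₀ ξ₀ : E} {A : E →L[ℝ] E}
    (hx₀ : a x₀ - 1 / 2 * ‖x₀‖ ^ 2 + inner ℝ x₀ ξ₀ = G ξ₀)
    (hA : ∀ ε > 0, ∃ r > 0, ∀ h, ‖h‖ < r →
        |G (ξ₀ + h) - G ξ₀ - inner ℝ x₀ h - 1 / 2 * inner ℝ (A h) h| ≤ ε * ‖h‖ ^ 2) :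
    ∀ ε > 0, ∃ r > 0, ∀ x ∈ C, ‖x - x₀‖ < r →
      a x ≤ a x₀ + inner ℝ (x₀ - ξ₀) (x - x₀) +
        1 / 2 * (inner ℝ (A (x - x₀)) (x - x₀) - ‖x - x₀‖ ^ 2) + ε * ‖x - x₀‖ ^ 2 := by
  intro ε hε
  obtain ⟨r, hr, H⟩ := hA ε hε
  refine ⟨r, hr, fun x hx hxr => ?_⟩
  have h1 := (abs_le.1 (H _ hxr)).2
  have h2 := hG (ξ₀ + (x - x₀)) x hx
  obtain ⟨h, rfl⟩ : ∃ h, x = x₀ + h := ⟨x - x₀, by abel⟩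
  simp only [add_sub_cancel_left] at *
  simp only [inner_add_left, inner_add_right, inner_sub_left, real_inner_self_eq_norm_sq,
    norm_add_sq_real] at *
  rw [real_inner_comm ξ₀ h] at h2
  linarith

theorem inner_nonneg_of_sup_convolution_expansion {C : Set E} {a G : E → ℝ}
    (hG : ∀ ξ, ∀ x ∈ C, a x - 1 / 2 * ‖x‖ ^ 2 + inner ℝ x ξ ≤ G ξ) {x₀ ξ₀ : E} {A : E →L[ℝ] E}
    (hxC : x₀ ∈ C) (hx₀ : a x₀ - 1 / 2 * ‖x₀‖ ^ 2 + inner ℝ x₀ ξ₀ = G ξ₀)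
    (hA : ∀ ε > 0, ∃ r > 0, ∀ h, ‖h‖ < r →
        |G (ξ₀ + h) - G ξ₀ - inner ℝ x₀ h - 1 / 2 * inner ℝ (A h) h| ≤ ε * ‖h‖ ^ 2) (v : E) :
    0 ≤ inner ℝ (A v) v := by
  rw [← neg_nonpos]
  refine nonpos_of_forall_small_sq (k := 2 * ‖v‖ ^ 2) fun ε hε => ?_
  obtain ⟨r, hr, H⟩ := hA ε hε
  have ht : 0 < r / (‖v‖ + 1) := by positivity
  refine ⟨r / (‖v‖ + 1), ht, ?_⟩
  set t := r / (‖v‖ + 1)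
  have hn : ‖t • v‖ < r := by
    rw [norm_smul, Real.norm_eq_abs, abs_of_pos ht, div_mul_eq_mul_div,
      div_lt_iff₀ (by positivity)]
    nlinarith [norm_nonneg v]
  have h1 := (abs_le.1 (H _ hn)).2
  have h2 := hG (ξ₀ + t • v) x₀ hxC
  rw [norm_smul, mul_pow, Real.norm_eq_abs, sq_abs] at h1
  simp only [map_smul, inner_add_right, real_inner_smul_left, real_inner_smul_right] at h1 h2
  linarith

/-- The theorem on sums, in a normalised quantitative form. -/
theorem theorem_on_sums [FiniteDimensional ℝ E] {C : Set E} (hC : IsCompact C) (hCn : C.Nonempty)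
    {a b : E → ℝ} (ha : ContinuousOn a C) (hb : ContinuousOn b C) {η : ℝ} (hη : 0 < η) :
    ∃ x₀ ∈ C, ∃ y₀ ∈ C, ∃ s₁ s₂ : E, ∃ A B : E →L[ℝ] E,
      (∀ x ∈ C, a x + b x ≤ a x₀ + b y₀ - 1 / 6 * ‖x₀ - y₀‖ ^ 2 + η) ∧
      (∀ ε > 0, ∃ r > 0, ∀ x ∈ C, ‖x - x₀‖ < r →
        a x ≤ a x₀ + inner ℝ s₁ (x - x₀) +
          1 / 2 * (inner ℝ (A (x - x₀)) (x - x₀) - ‖x - x₀‖ ^ 2) + ε * ‖x - x₀‖ ^ 2) ∧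
      (∀ ε > 0, ∃ r > 0, ∀ y ∈ C, ‖y - y₀‖ < r →
        b y ≤ b y₀ + inner ℝ s₂ (y - y₀) +
          1 / 2 * (inner ℝ (B (y - y₀)) (y - y₀) - ‖y - y₀‖ ^ 2) + ε * ‖y - y₀‖ ^ 2) ∧
      (∀ v, 0 ≤ inner ℝ (A v) v) ∧ (∀ v, 0 ≤ inner ℝ (B v) v) ∧
      ∀ v w, inner ℝ (A v) v + inner ℝ (B w) w ≤
        2 * ‖v‖ ^ 2 + 2 * ‖w‖ ^ 2 - 2 * inner ℝ v w := by
  obtain ⟨G₁, hG₁, hG₁'⟩ := exists_sup_convolution hC hCn ha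
  obtain ⟨G₂, hG₂, hG₂'⟩ := exists_sup_convolution hC hCn hb
  let e := WithLp.prodContinuousLinearEquiv 2 ℝ E E
  let S : Set (WithLp 2 (E × E)) := e.symm '' (C ×ˢ C)
  have hmemS : ∀ z, z ∈ S ↔ z.fst ∈ C ∧ z.snd ∈ C := by
    intro z
    constructor
    · rintro ⟨q, hq, rfl⟩
      exact hq
    · intro h
      exact ⟨(z.fst, z.snd), h, rfl⟩
  have hS : IsCompact S := (hC.prod hC).image e.symm.continuous
  have hSn : S.Nonempty := (hCn.prod hCn).image _
  let g : WithLp 2 (E × E) → ℝ := fun z =>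
    (a z.fst - 1 / 2 * ‖z.fst‖ ^ 2) + (b z.snd - 1 / 2 * ‖z.snd‖ ^ 2)
  have hfst : Continuous (fun z : WithLp 2 (E × E) => z.fst) := continuous_fst.comp e.continuous
  have hsnd : Continuous (fun z : WithLp 2 (E × E) => z.snd) := continuous_snd.comp e.continuous
  have hg : ContinuousOn g S := by
    refine ContinuousOn.add (ContinuousOn.sub ?_ ?_) (ContinuousOn.sub ?_ ?_)
    · exact ha.comp hfst.continuousOn fun z hz => ((hmemS z).1 hz).1
    · exact (continuous_const.mul ((hfst.norm).pow 2)).continuousOn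
    · exact hb.comp hsnd.continuousOn fun z hz => ((hmemS z).1 hz).2
    · exact (continuous_const.mul ((hsnd.norm).pow 2)).continuousOn
  have hin : ∀ x y : WithLp 2 (E × E), inner ℝ x y = inner ℝ x.fst y.fst + inner ℝ x.snd y.snd :=
    fun x y => rfl
  have hnorm : ∀ x : WithLp 2 (E × E), ‖x‖ ^ 2 = ‖x.fst‖ ^ 2 + ‖x.snd‖ ^ 2 := fun x => by
    rw [← real_inner_self_eq_norm_sq, hin, real_inner_self_eq_norm_sq, real_inner_self_eq_norm_sq]
  have hQself : ∀ x : WithLp 2 (E × E), inner ℝ (doublingOp E x) x =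
      2 * ‖x.fst‖ ^ 2 + 2 * ‖x.snd‖ ^ 2 - 2 * inner ℝ x.fst x.snd := fun x => by
    rw [inner_doublingOp, real_inner_self_eq_norm_sq, real_inner_self_eq_norm_sq,
      real_inner_comm x.fst x.snd]
    ring
  have hQs : ∀ x y : WithLp 2 (E × E),
      inner ℝ (doublingOp E x) y = inner ℝ x (doublingOp E y) := fun x y => by
    rw [inner_doublingOp, real_inner_comm (doublingOp E y) x, inner_doublingOp,
      real_inner_comm x.fst y.fst, real_inner_comm x.fst y.snd, real_inner_comm x.snd y.snd,
      real_inner_comm x.snd y.fst]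
    ring
  have hQ1 : ∀ x : WithLp 2 (E × E), ‖x‖ ^ 2 ≤ inner ℝ (doublingOp E x) x := fun x => by
    rw [hQself, hnorm]
    have := norm_sub_sq_real x.fst x.snd
    nlinarith [sq_nonneg ‖x.fst - x.snd‖]
  have hQ3 : ∀ x : WithLp 2 (E × E), inner ℝ (doublingOp E x) x ≤ 3 * ‖x‖ ^ 2 := fun x => by
    rw [hQself, hnorm]
    have := norm_add_sq_real x.fst x.snd
    nlinarith [sq_nonneg ‖x.fst + x.snd‖]
  let G : WithLp 2 (E × E) → ℝ := fun ζ => G₁ ζ.fst + G₂ ζ.snd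
  have hG1 : ∀ ζ, ∀ z ∈ S, g z + inner ℝ z ζ ≤ G ζ := by
    intro ζ z hz
    have h1 := hG₁ ζ.fst z.fst ((hmemS z).1 hz).1
    have h2 := hG₂ ζ.snd z.snd ((hmemS z).1 hz).2
    simp only [g, G, hin]
    linarith
  have hG2 : ∀ ζ, ∃ z ∈ S, g z + inner ℝ z ζ = G ζ := by
    intro ζ
    obtain ⟨x, hx, h1⟩ := hG₁' ζ.fst
    obtain ⟨y, hy, h2⟩ := hG₂' ζ.snd
    refine ⟨WithLp.toLp 2 (x, y), (hmemS _).2 ⟨hx, hy⟩, ?_⟩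
    simp only [g, G, hin]
    change (a x - 1 / 2 * ‖x‖ ^ 2) + (b y - 1 / 2 * ‖y‖ ^ 2) +
      (inner ℝ x ζ.fst + inner ℝ y ζ.snd) = _
    linarith
  obtain ⟨D, hD⟩ := hS.isBounded.exists_norm_le
  set δ := min 1 (η / (2 * |D| + 1)) with hδdef
  have hδ : 0 < δ := by positivity
  have hδ1 : δ ≤ 1 := min_le_left _ _
  have hδη : δ * (2 * |D| + 1) ≤ η := (le_div_iff₀ (by positivity)).1 (min_le_right _ _)
  obtain ⟨z, hz, ζ, hp, hzG, hmax, B, hB⟩ :=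
    exists_isMax_second_order_expansion hS hSn hg hQs hQ1 hQ3 hG1 hG2 hδ
  obtain ⟨hx₀, hy₀⟩ := (hmemS z).1 hz
  have hxG : a z.fst - 1 / 2 * ‖z.fst‖ ^ 2 + inner ℝ z.fst ζ.fst = G₁ ζ.fst := by
    have h1 := hG₁ ζ.fst z.fst hx₀
    have h2 := hG₂ ζ.snd z.snd hy₀
    simp only [g, G, hin] at hzG
    linarith
  have hyG : b z.snd - 1 / 2 * ‖z.snd‖ ^ 2 + inner ℝ z.snd ζ.snd = G₂ ζ.snd := by
    simp only [g, G, hin] at hzG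
    linarith
  let ι₁ : E →L[ℝ] WithLp 2 (E × E) := e.symm.toContinuousLinearMap ∘L ContinuousLinearMap.inl ℝ E E
  let ι₂ : E →L[ℝ] WithLp 2 (E × E) := e.symm.toContinuousLinearMap ∘L ContinuousLinearMap.inr ℝ E E
  let π₁ : WithLp 2 (E × E) →L[ℝ] E := ContinuousLinearMap.fst ℝ E E ∘L e.toContinuousLinearMap
  let π₂ : WithLp 2 (E × E) →L[ℝ] E := ContinuousLinearMap.snd ℝ E E ∘L e.toContinuousLinearMap
  let A₁ : E →L[ℝ] E := π₁ ∘L B ∘L ι₁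
  let A₂ : E →L[ℝ] E := π₂ ∘L B ∘L ι₂
  have f1 : ∀ h, (ι₁ h).fst = h := fun h => rfl
  have f2 : ∀ h, (ι₁ h).snd = 0 := fun h => rfl
  have f3 : ∀ h, (ι₂ h).fst = 0 := fun h => rfl
  have f4 : ∀ h, (ι₂ h).snd = h := fun h => rfl
  have f5 : ∀ h, inner ℝ (B (ι₁ h)) (ι₁ h) = inner ℝ (A₁ h) h := fun h => by
    rw [hin, f2, inner_zero_right, add_zero]; rfl
  have f6 : ∀ h, inner ℝ (B (ι₂ h)) (ι₂ h) = inner ℝ (A₂ h) h := fun h => by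
    rw [hin, f3, inner_zero_right, zero_add]; rfl
  have f7 : ∀ h, ‖ι₁ h‖ = ‖h‖ := fun h => by
    have := hnorm (ι₁ h)
    rw [f1, f2, norm_zero] at this
    exact (pow_left_inj₀ (norm_nonneg _) (norm_nonneg _) two_ne_zero).1 (by simpa using this)
  have f8 : ∀ h, ‖ι₂ h‖ = ‖h‖ := fun h => by
    have := hnorm (ι₂ h)
    rw [f3, f4, norm_zero] at this
    exact (pow_left_inj₀ (norm_nonneg _) (norm_nonneg _) two_ne_zero).1 (by simpa using this)
  have hA₁ : ∀ ε > 0, ∃ r > 0, ∀ h, ‖h‖ < r →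
      |G₁ (ζ.fst + h) - G₁ ζ.fst - inner ℝ z.fst h - 1 / 2 * inner ℝ (A₁ h) h| ≤
        ε * ‖h‖ ^ 2 := by
    intro ε hε
    obtain ⟨r, hr, H⟩ := hB ε hε
    refine ⟨r, hr, fun h hh => ?_⟩
    have := H (ι₁ h) (by rwa [f7])
    simp only [G, f5, f7, hin z, f1, f2, inner_zero_right, WithLp.add_fst, WithLp.add_snd,
      add_zero] at this
    rwa [add_sub_add_right_eq_sub] at this
  have hA₂ : ∀ ε > 0, ∃ r > 0, ∀ h, ‖h‖ < r →
      |G₂ (ζ.snd + h) - G₂ ζ.snd - inner ℝ z.snd h - 1 / 2 * inner ℝ (A₂ h) h| ≤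
        ε * ‖h‖ ^ 2 := by
    intro ε hε
    obtain ⟨r, hr, H⟩ := hB ε hε
    refine ⟨r, hr, fun h hh => ?_⟩
    have := H (ι₂ h) (by rwa [f8])
    simp only [G, f6, f8, hin z, f3, f4, inner_zero_right, WithLp.add_fst, WithLp.add_snd,
      add_zero, zero_add] at this
    rwa [add_sub_add_left_eq_sub] at this
  refine ⟨z.fst, hx₀, z.snd, hy₀, z.fst - ζ.fst, z.snd - ζ.snd, A₁, A₂, ?_,
    le_of_sup_convolution_expansion hG₁ hxG hA₁, le_of_sup_convolution_expansion hG₂ hyG hA₂,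
    inner_nonneg_of_sup_convolution_expansion hG₁ hx₀ hxG hA₁,
    inner_nonneg_of_sup_convolution_expansion hG₂ hy₀ hyG hA₂, ?_⟩
  · intro x hx
    let w : WithLp 2 (E × E) := WithLp.toLp 2 (x, x)
    have hw : w ∈ S := (hmemS w).2 ⟨hx, hx⟩
    have w1 : w.fst = x := rfl
    have w2 : w.snd = x := rfl
    have h1 := hmax w
    have h2 := hG1 w w hw
    rw [← hzG, hQself, hQself] at h1
    have hζ : ‖ζ‖ ≤ |D| + δ := by
      have h3 : ‖ζ‖ ^ 2 ≤ ‖doublingOp E ζ‖ * ‖ζ‖ := (hQ1 ζ).trans (real_inner_le_norm _ _)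
      have h4 : ‖ζ‖ ≤ ‖doublingOp E ζ‖ := by
        rcases eq_or_lt_of_le (norm_nonneg ζ) with h0 | h0
        · rw [← h0]; positivity
        · rw [pow_two] at h3
          exact le_of_mul_le_mul_right h3 h0
      have h5 : ‖doublingOp E ζ‖ ≤ ‖z‖ + ‖z - doublingOp E ζ‖ := by
        calc ‖doublingOp E ζ‖ = ‖z - (z - doublingOp E ζ)‖ := by congr 1; abel
          _ ≤ _ := norm_sub_le _ _
      have h6 := (hD z hz).trans (le_abs_self D)
      linarith
    have hpw : inner ℝ (z - doublingOp E ζ) w - inner ℝ (z - doublingOp E ζ) ζ ≤ η := by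
      rw [← inner_sub_right]
      have h6 := (hD w hw).trans (le_abs_self D)
      have h7 : ‖w - ζ‖ ≤ 2 * |D| + 1 := by
        have := norm_sub_le w ζ
        linarith
      calc _ ≤ ‖z - doublingOp E ζ‖ * ‖w - ζ‖ := real_inner_le_norm _ _
        _ ≤ δ * (2 * |D| + 1) := by gcongr
        _ ≤ η := hδη
    simp only [g, hin w, hin z ζ, w1, w2, real_inner_self_eq_norm_sq] at h1 h2
    have h8 : 1 / 6 * ‖z.fst - z.snd‖ ^ 2 ≤ 1 / 2 * ‖z.fst - ζ.fst‖ ^ 2 +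
        1 / 2 * ‖ζ.fst - ζ.snd‖ ^ 2 + 1 / 2 * ‖ζ.snd - z.snd‖ ^ 2 := by
      have h9 : ‖z.fst - z.snd‖ ≤ ‖z.fst - ζ.fst‖ + ‖ζ.fst - ζ.snd‖ + ‖ζ.snd - z.snd‖ := by
        calc ‖z.fst - z.snd‖ =
            ‖(z.fst - ζ.fst) + (ζ.fst - ζ.snd) + (ζ.snd - z.snd)‖ := by congr 1; abel
          _ ≤ _ := norm_add₃_le
      have h10 := pow_le_pow_left₀ (norm_nonneg _) h9 2
      nlinarith [sq_nonneg (‖z.fst - ζ.fst‖ - ‖ζ.fst - ζ.snd‖),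
        sq_nonneg (‖z.fst - ζ.fst‖ - ‖ζ.snd - z.snd‖),
        sq_nonneg (‖ζ.fst - ζ.snd‖ - ‖ζ.snd - z.snd‖)]
    rw [norm_sub_sq_real z.fst ζ.fst, norm_sub_sq_real ζ.fst ζ.snd,
      norm_sub_sq_real ζ.snd z.snd, real_inner_comm z.snd ζ.snd] at h8
    linarith
  · intro v w
    rw [← sub_nonpos]
    refine nonpos_of_forall_small_sq (k := 2 * (‖v‖ ^ 2 + ‖w‖ ^ 2)) fun ε hε => ?_
    obtain ⟨r₁, hr₁, H₁⟩ := hA₁ ε hε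
    obtain ⟨r₂, hr₂, H₂⟩ := hA₂ ε hε
    have ht : 0 < min r₁ r₂ / (‖v‖ + ‖w‖ + 1) := by
      have := lt_min hr₁ hr₂
      positivity
    refine ⟨min r₁ r₂ / (‖v‖ + ‖w‖ + 1), ht, ?_⟩
    set t := min r₁ r₂ / (‖v‖ + ‖w‖ + 1) with htdef
    have hm := lt_min hr₁ hr₂
    have hv : ‖t • v‖ < min r₁ r₂ := by
      rw [norm_smul, Real.norm_eq_abs, abs_of_pos ht, htdef, div_mul_eq_mul_div,
        div_lt_iff₀ (by positivity)]
      nlinarith [norm_nonneg v, norm_nonneg w]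
    have hw : ‖t • w‖ < min r₁ r₂ := by
      rw [norm_smul, Real.norm_eq_abs, abs_of_pos ht, htdef, div_mul_eq_mul_div,
        div_lt_iff₀ (by positivity)]
      nlinarith [norm_nonneg v, norm_nonneg w]
    have h1 := (abs_le.1 (H₁ _ (hv.trans_le (min_le_left _ _)))).1
    have h2 := (abs_le.1 (H₂ _ (hw.trans_le (min_le_right _ _)))).1
    have h3 := hmax (ζ + (ι₁ (t • v) + ι₂ (t • w)))
    rw [norm_smul, mul_pow, Real.norm_eq_abs, sq_abs] at h1 h2
    rw [hQself, hQself, inner_sub_left, inner_sub_left, inner_doublingOp,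
      inner_doublingOp] at h3
    simp only [G, hin z, WithLp.add_fst, WithLp.add_snd, f1, f2, f3, f4, add_zero, zero_add,
      norm_add_sq_real, norm_smul, mul_pow, Real.norm_eq_abs, sq_abs, inner_add_left,
      inner_add_right, real_inner_smul_left, real_inner_smul_right] at h3
    simp only [map_smul, real_inner_smul_left, real_inner_smul_right] at h1 h2
    rw [real_inner_comm ζ.snd v] at h3
    linarith

end Sums

section Hessians

variable {N : ℕ}

/-- The matrix of a bilinear form in the canonical basis. -/
def bilinMatrix (B : Euc N →L[ℝ] Euc N →L[ℝ] ℝ) : Matrix (Fin N) (Fin N) ℝ :=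
  Matrix.of fun i j => B (EuclideanSpace.single i 1) (EuclideanSpace.single j 1)

/-- The inner product as a bilinear form. -/
def innerBilin (N : ℕ) : Euc N →L[ℝ] Euc N →L[ℝ] ℝ :=
  (isBoundedBilinearMap_inner (𝕜 := ℝ) (E := Euc N)).toContinuousLinearMap

theorem innerBilin_apply (v w : Euc N) : innerBilin N v w = inner ℝ v w := rfl

theorem bilinMatrix_add (B B' : Euc N →L[ℝ] Euc N →L[ℝ] ℝ) :
    bilinMatrix (B + B') = bilinMatrix B + bilinMatrix B' := rfl

theorem bilinMatrix_sub (B B' : Euc N →L[ℝ] Euc N →L[ℝ] ℝ) :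
    bilinMatrix (B - B') = bilinMatrix B - bilinMatrix B' := rfl

theorem bilinMatrix_smul (c : ℝ) (B : Euc N →L[ℝ] Euc N →L[ℝ] ℝ) :
    bilinMatrix (c • B) = c • bilinMatrix B := rfl

theorem bilinMatrix_innerBilin : bilinMatrix (innerBilin N) = 1 := by
  ext i j
  simp [bilinMatrix, innerBilin_apply, Matrix.one_apply, EuclideanSpace.inner_single_left]

theorem dotProduct_bilinMatrix_mulVec (B : Euc N →L[ℝ] Euc N →L[ℝ] ℝ) (v w : Fin N → ℝ) :
    v ⬝ᵥ bilinMatrix B *ᵥ w = B (WithLp.toLp 2 v) (WithLp.toLp 2 w) := by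
  have h : ∀ v : Fin N → ℝ,
      WithLp.toLp 2 v = ∑ i, v i • (EuclideanSpace.single i 1 : Euc N) := by
    intro v
    ext j
    simp [Finset.sum_apply, Pi.single_apply]
  rw [h v, h w]
  simp only [map_sum, map_smul, _root_.sum_apply, _root_.smul_apply,
    smul_eq_mul, dotProduct, Matrix.mulVec, bilinMatrix, Matrix.of_apply, Finset.mul_sum]
  rw [Finset.sum_comm]
  refine Finset.sum_congr rfl fun i _ => Finset.sum_congr rfl fun j _ => ?_
  ring

theorem bilinMatrix_isSymm {B : Euc N →L[ℝ] Euc N →L[ℝ] ℝ} (hB : ∀ v w, B v w = B w v) :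
    (bilinMatrix B).IsSymm := by
  ext i j
  exact hB _ _

theorem bilinMatrix_posSemidef {B : Euc N →L[ℝ] Euc N →L[ℝ] ℝ} (hB : ∀ v w, B v w = B w v)
    (h0 : ∀ v, 0 ≤ B v v) : (bilinMatrix B).PosSemidef := by
  refine Matrix.PosSemidef.of_dotProduct_mulVec_nonneg ?_ fun v => ?_
  · ext i j
    exact hB _ _
  · rw [star_trivial, dotProduct_bilinMatrix_mulVec]
    exact h0 _

theorem hessianMatrix_eq_bilinMatrix (φ : Euc N → ℝ) (x : Euc N) :
    hessianMatrix φ x = bilinMatrix (fderiv ℝ (fderiv ℝ φ) x) := by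
  ext i j
  simp [hessianMatrix, bilinMatrix, iteratedFDeriv_two_apply]

theorem fderiv_fderiv_comm {φ : Euc N → ℝ} (hφ : ContDiff ℝ 2 φ) (x v w : Euc N) :
    fderiv ℝ (fderiv ℝ φ) x v w = fderiv ℝ (fderiv ℝ φ) x w v :=
  (hφ.contDiffAt.isSymmSndFDerivAt (by simp)) v w

theorem hessianMatrix_isSymm {φ : Euc N → ℝ} (hφ : ContDiff ℝ 2 φ) (x : Euc N) :
    (hessianMatrix φ x).IsSymm := by
  rw [hessianMatrix_eq_bilinMatrix]
  exact bilinMatrix_isSymm (fderiv_fderiv_comm hφ x)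

theorem hessianMatrix_eq_of_hasFDerivAt {φ : Euc N → ℝ} {φ' : Euc N → Euc N →L[ℝ] ℝ}
    (h : ∀ x, HasFDerivAt φ (φ' x) x) {x : Euc N} {B : Euc N →L[ℝ] Euc N →L[ℝ] ℝ}
    (hB : HasFDerivAt φ' B x) : hessianMatrix φ x = bilinMatrix B := by
  rw [hessianMatrix_eq_bilinMatrix, funext fun x => (h x).fderiv, hB.fderiv]

theorem hasFDerivAt_fderiv {φ : Euc N → ℝ} (hφ : ContDiff ℝ 2 φ) (x : Euc N) :
    HasFDerivAt (fderiv ℝ φ) (fderiv ℝ (fderiv ℝ φ) x) x :=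
  ((hφ.fderiv_right (m := 1) (by norm_num)).differentiable one_ne_zero x).hasFDerivAt

theorem hessianMatrix_smul_sub_smul {φ ψ : Euc N → ℝ} (hφ : ContDiff ℝ 2 φ)
    (hψ : ContDiff ℝ 2 ψ) (c d : ℝ) (x : Euc N) :
    hessianMatrix (fun x => c * φ x - d * ψ x) x =
      c • hessianMatrix φ x - d • hessianMatrix ψ x := by
  rw [hessianMatrix_eq_bilinMatrix φ, hessianMatrix_eq_bilinMatrix ψ, ← bilinMatrix_smul,
    ← bilinMatrix_smul, ← bilinMatrix_sub]
  refine hessianMatrix_eq_of_hasFDerivAt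
    (φ' := fun x => c • fderiv ℝ φ x - d • fderiv ℝ ψ x) (fun x => ?_)
    (((hasFDerivAt_fderiv hφ x).const_smul c).sub ((hasFDerivAt_fderiv hψ x).const_smul d))
  exact ((hφ.differentiable two_ne_zero x).hasFDerivAt.const_mul c).sub
    ((hψ.differentiable two_ne_zero x).hasFDerivAt.const_mul d)

theorem hessianMatrix_quadratic {B : Euc N →L[ℝ] Euc N →L[ℝ] ℝ} (hB : ∀ v w, B v w = B w v)
    (c : ℝ) (s x₀ x : Euc N) :
    hessianMatrix (fun x => c + inner ℝ s (x - x₀) + 1 / 2 * B (x - x₀) (x - x₀)) x =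
      bilinMatrix B := by
  refine hessianMatrix_eq_of_hasFDerivAt (φ' := fun x => innerBilin N s + B (x - x₀))
    (fun x => ?_) ?_
  · have h1 : HasFDerivAt (fun x => x - x₀) (ContinuousLinearMap.id ℝ (Euc N)) x :=
      (hasFDerivAt_id x).sub_const x₀
    have h2 := (((innerBilin N s).hasFDerivAt.comp x h1).const_add c).add
      ((B.isBoundedBilinearMap.hasFDerivAt (x - x₀, x - x₀)).comp x (h1.prodMk h1)
        |>.const_mul (1 / 2))
    refine h2.congr_fderiv ?_
    ext v
    simp [hB v]
    ring
  · exact ((B.hasFDerivAt).comp x ((hasFDerivAt_id x).sub_const x₀)).const_add _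

theorem contDiff_quadratic (B : Euc N →L[ℝ] Euc N →L[ℝ] ℝ) (c : ℝ) (s x₀ : Euc N) :
    ContDiff ℝ 2 fun x => c + inner ℝ s (x - x₀) + 1 / 2 * B (x - x₀) (x - x₀) := by
  change ContDiff ℝ 2 fun x => c + innerBilin N s (x - x₀) + 1 / 2 * B (x - x₀) (x - x₀)
  fun_prop

end Hessians

section Jets

variable {N : ℕ}

/-- The symmetric bilinear form with the same quadratic form as an operator. -/
def symmBilin (A : Euc N →L[ℝ] Euc N) : Euc N →L[ℝ] Euc N →L[ℝ] ℝ :=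
  (1 / 2 : ℝ) • (innerBilin N ∘L A + (innerBilin N ∘L A).flip)

theorem symmBilin_comm (A : Euc N →L[ℝ] Euc N) (v w : Euc N) :
    symmBilin A v w = symmBilin A w v := by
  change 1 / 2 * (inner ℝ (A v) w + inner ℝ (A w) v) = 1 / 2 * (inner ℝ (A w) v + inner ℝ (A v) w)
  ring

theorem symmBilin_self (A : Euc N →L[ℝ] Euc N) (v : Euc N) :
    symmBilin A v v = inner ℝ (A v) v := by
  change 1 / 2 * (inner ℝ (A v) v + inner ℝ (A v) v) = inner ℝ (A v) v
  ring

theorem innerBilin_self (v : Euc N) : innerBilin N v v = ‖v‖ ^ 2 := real_inner_self_eq_norm_sq v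

theorem posSemidef_fromBlocks {P Q R : Euc N →L[ℝ] Euc N →L[ℝ] ℝ}
    (hP : ∀ v w, P v w = P w v) (hQ : ∀ v w, Q v w = Q w v) (hR : ∀ v w, R v w = R w v)
    (h : ∀ v w, 0 ≤ P v v + 2 * Q v w + R w w) :
    (Matrix.fromBlocks (bilinMatrix P) (bilinMatrix Q) (bilinMatrix Q)
      (bilinMatrix R)).PosSemidef := by
  refine Matrix.PosSemidef.of_dotProduct_mulVec_nonneg ?_ fun z => ?_
  · refine Matrix.IsHermitian.fromBlocks ?_ ?_ ?_
    · exact bilinMatrix_isSymm hP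
    · exact bilinMatrix_isSymm hQ
    · exact bilinMatrix_isSymm hR
  · obtain ⟨v, w, rfl⟩ : ∃ v w, z = Sum.elim v w := ⟨z ∘ Sum.inl, z ∘ Sum.inr, by simp⟩
    rw [star_trivial, Matrix.fromBlocks_mulVec, Sum.elim_comp_inl, Sum.elim_comp_inr,
      sumElim_dotProduct_sumElim, dotProduct_add, dotProduct_add]
    simp only [dotProduct_bilinMatrix_mulVec]
    have := h (WithLp.toLp 2 v) (WithLp.toLp 2 w)
    rw [hQ (WithLp.toLp 2 w)]
    linarith

theorem exists_testFunctions {C : Set (Euc N)} (hC : IsCompact C) (hCn : C.Nonempty)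
    {u v : Euc N → ℝ} (hu : ContinuousOn u C) (hv : ContinuousOn v C) {α η : ℝ} (hα : 0 < α)
    (hη : 0 < η) :
    ∃ x₀ ∈ C, ∃ y₀ ∈ C, ∃ X Y : Matrix (Fin N) (Fin N) ℝ, X.IsSymm ∧ Y.IsSymm ∧
      MatLE ((-(3 * α)) • (1 : Matrix (Fin N ⊕ Fin N) (Fin N ⊕ Fin N) ℝ))
        (Matrix.fromBlocks X 0 0 (-Y)) ∧
      MatLE (Matrix.fromBlocks X 0 0 (-Y))
        ((3 * α) • Matrix.fromBlocks 1 (-1) (-1) 1) ∧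
      (∀ x ∈ C, u x - v x ≤ u x₀ - v y₀ - α / 2 * ‖x₀ - y₀‖ ^ 2 + η) ∧
      (∀ ε > 0, ∃ φ : Euc N → ℝ, ContDiff ℝ 2 φ ∧ u x₀ = φ x₀ ∧
        IsLocalMaxOn (fun x => u x - φ x) C x₀ ∧ hessianMatrix φ x₀ = X + (ε : ℝ) • 1) ∧
      ∀ ε > 0, ∃ φ : Euc N → ℝ, ContDiff ℝ 2 φ ∧ v y₀ = φ y₀ ∧
        IsLocalMinOn (fun y => v y - φ y) C y₀ ∧ hessianMatrix φ y₀ = Y - (ε : ℝ) • 1 := by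
  have hc : 0 < 3 * α := by positivity
  obtain ⟨x₀, hx₀, y₀, hy₀, s₁, s₂, A, B, h1, hA, hB, hA0, hB0, hAB⟩ :=
    theorem_on_sums hC hCn (hu.div_const (3 * α)) (hv.neg.div_const (3 * α)) (div_pos hη hc)
  have hin : ∀ v w : Euc N, innerBilin N v w = innerBilin N w v := fun v w => by
    rw [innerBilin_apply, innerBilin_apply, real_inner_comm]
  set P : Euc N →L[ℝ] Euc N →L[ℝ] ℝ := (3 * α) • (symmBilin A - innerBilin N) with hP
  set R : Euc N →L[ℝ] Euc N →L[ℝ] ℝ := (-(3 * α)) • (symmBilin B - innerBilin N) with hR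
  have hPc : ∀ v w, P v w = P w v := fun v w => by
    simp [hP, symmBilin_comm A v w, hin v w]
  have hRc : ∀ v w, R v w = R w v := fun v w => by
    simp [hR, symmBilin_comm B v w, hin v w]
  have hPs : ∀ v, P v v = 3 * α * (inner ℝ (A v) v - ‖v‖ ^ 2) := fun v => by
    simp [hP, symmBilin_self, innerBilin_self]
  have hRs : ∀ v, R v v = -(3 * α) * (inner ℝ (B v) v - ‖v‖ ^ 2) := fun v => by
    simp [hR, symmBilin_self, innerBilin_self]
  clear_value P R
  refine ⟨x₀, hx₀, y₀, hy₀, bilinMatrix P, bilinMatrix R, bilinMatrix_isSymm hPc,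
    bilinMatrix_isSymm hRc, ?_, ?_, ?_, ?_, ?_⟩
  · have := posSemidef_fromBlocks (P := P + (3 * α) • innerBilin N) (Q := 0)
      (R := (-1 : ℝ) • R + (3 * α) • innerBilin N)
      (fun v w => by simp [hPc v w, hin v w]) (fun v w => by simp)
      (fun v w => by simp [hRc v w, hin v w])
      (fun v w => by
        simp only [_root_.add_apply, _root_.smul_apply, hPs, hRs, innerBilin_self, smul_eq_mul,
          _root_.zero_apply]
        nlinarith [mul_nonneg hc.le (hA0 v), mul_nonneg hc.le (hB0 w)])
    rw [MatLE]
    convert this using 1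
    rw [← Matrix.fromBlocks_one, Matrix.fromBlocks_smul, sub_eq_add_neg, Matrix.fromBlocks_neg,
      Matrix.fromBlocks_add]
    have h0 : bilinMatrix (0 : Euc N →L[ℝ] Euc N →L[ℝ] ℝ) = 0 := rfl
    simp [h0, bilinMatrix_add, bilinMatrix_smul, bilinMatrix_innerBilin]
  · have := posSemidef_fromBlocks (P := (-1 : ℝ) • P + (3 * α) • innerBilin N)
      (Q := (-(3 * α)) • innerBilin N) (R := R + (3 * α) • innerBilin N)
      (fun v w => by simp [hPc v w, hin v w]) (fun v w => by simp [hin v w])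
      (fun v w => by simp [hRc v w, hin v w])
      (fun v w => by
        simp only [_root_.add_apply, _root_.smul_apply, hPs, hRs, innerBilin_self, smul_eq_mul,
          innerBilin_apply v w]
        nlinarith [mul_le_mul_of_nonneg_left (hAB v w) hc.le])
    rw [MatLE]
    convert this using 1
    rw [Matrix.fromBlocks_smul, sub_eq_add_neg, Matrix.fromBlocks_neg,
      Matrix.fromBlocks_add]
    simp only [bilinMatrix_add, bilinMatrix_smul, bilinMatrix_innerBilin, smul_neg, neg_smul,
      one_smul, neg_zero, add_zero, neg_neg]
    congr 1 <;> abel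
  · intro x hx
    have h2 := mul_le_mul_of_nonneg_left (h1 x hx) hc.le
    have e : ∀ t : ℝ, 3 * α * (t / (3 * α)) = t := fun t => by field_simp
    simp only [mul_add, mul_sub, e, Pi.neg_apply] at h2
    linarith
  · intro ε hε
    obtain ⟨r, hr, H⟩ := hA (ε / (2 * (3 * α))) (by positivity)
    have hcomm : ∀ v w, (P + ε • innerBilin N) v w = (P + ε • innerBilin N) w v := fun v w => by
      simp [hPc v w, hin v w]
    refine ⟨_, contDiff_quadratic (P + ε • innerBilin N) (u x₀) ((3 * α) • s₁) x₀, ?_, ?_, ?_⟩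
    · simp
    · filter_upwards [mem_nhdsWithin_of_mem_nhds (Metric.ball_mem_nhds x₀ hr),
        self_mem_nhdsWithin] with x hxr hx
      have h2 := mul_le_mul_of_nonneg_left (H x hx (by rwa [← dist_eq_norm])) hc.le
      have e : ∀ t : ℝ, 3 * α * (t / (3 * α)) = t := fun t => by field_simp
      have e2 : 3 * α * (ε / (2 * (3 * α)) * ‖x - x₀‖ ^ 2) = ε / 2 * ‖x - x₀‖ ^ 2 := by
        field_simp
      simp only [mul_add, e, e2] at h2
      simp only [_root_.add_apply, _root_.smul_apply, hPs, innerBilin_self, smul_eq_mul,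
        real_inner_smul_left, sub_self, inner_zero_right, map_zero]
      linarith
    · rw [hessianMatrix_quadratic hcomm, bilinMatrix_add, bilinMatrix_smul,
        bilinMatrix_innerBilin]
  · intro ε hε
    obtain ⟨r, hr, H⟩ := hB (ε / (2 * (3 * α))) (by positivity)
    have hcomm : ∀ v w, (R - ε • innerBilin N) v w = (R - ε • innerBilin N) w v := fun v w => by
      simp [hRc v w, hin v w]
    refine ⟨_, contDiff_quadratic (R - ε • innerBilin N) (v y₀) ((-(3 * α)) • s₂) y₀, ?_, ?_, ?_⟩
    · simp
    · filter_upwards [mem_nhdsWithin_of_mem_nhds (Metric.ball_mem_nhds y₀ hr),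
        self_mem_nhdsWithin] with x hxr hx
      have h2 := mul_le_mul_of_nonneg_left (H x hx (by rwa [← dist_eq_norm])) hc.le
      have e : ∀ t : ℝ, 3 * α * (t / (3 * α)) = t := fun t => by field_simp
      have e2 : 3 * α * (ε / (2 * (3 * α)) * ‖x - y₀‖ ^ 2) = ε / 2 * ‖x - y₀‖ ^ 2 := by
        field_simp
      simp only [mul_add, e, e2, Pi.neg_apply] at h2
      simp only [_root_.sub_apply, _root_.smul_apply, hRs, innerBilin_self, smul_eq_mul,
        real_inner_smul_left, sub_self, inner_zero_right, map_zero]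
      linarith
    · rw [hessianMatrix_quadratic hcomm, bilinMatrix_sub, bilinMatrix_smul,
        bilinMatrix_innerBilin]

end Jets

section Comparison

variable {N : ℕ}

theorem le_of_testFunctions_above {Ω : Set (Euc N)} {F : Euc N → Matrix (Fin N) (Fin N) ℝ → ℝ}
    {lam Lam : ℝ} (hF1 : IsF1 Ω F lam Lam) {u a : Euc N → ℝ}
    (hsub : ViscSubsol Ω (fun x _ M => F x M - a x) u) {x : Euc N} (hx : x ∈ Ω)
    {X : Matrix (Fin N) (Fin N) ℝ} (hX : X.IsSymm)
    (h : ∀ ε > 0, ∃ φ : Euc N → ℝ, ContDiff ℝ 2 φ ∧ u x = φ x ∧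
        IsLocalMaxOn (fun x => u x - φ x) (closure Ω) x ∧
        hessianMatrix φ x = X + (ε : ℝ) • 1) : a x ≤ F x X := by
  refine le_of_forall_pos_le_add fun δ hδ => ?_
  have hLam : 0 < Lam := hF1.1.trans_le hF1.2.1
  obtain ⟨φ, hφ, hφx, hmax, hH⟩ := h (δ / (Lam * (N + 1))) (by positivity)
  have h1 := hsub x hx φ hφ hφx (hmax.on_subset subset_closure)
  have h2 := (hF1.2.2 x hx X ((δ / (Lam * (N + 1))) • 1) hX
    (Matrix.PosSemidef.one.smul (by positivity))).2
  rw [Matrix.trace_smul, Matrix.trace_one, Fintype.card_fin, smul_eq_mul] at h2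
  have h3 : Lam * (δ / (Lam * (N + 1)) * N) ≤ δ := by
    rw [← mul_assoc, mul_div_assoc', mul_div_mul_left _ _ hLam.ne', div_mul_eq_mul_div,
      div_le_iff₀ (by positivity)]
    nlinarith
  simp only [hH] at h1
  linarith

theorem le_of_testFunctions_below {Ω : Set (Euc N)} {F : Euc N → Matrix (Fin N) (Fin N) ℝ → ℝ}
    {lam Lam : ℝ} (hF1 : IsF1 Ω F lam Lam) {v b : Euc N → ℝ}
    (hsup : ViscSupersol Ω (fun x _ M => F x M - b x) v) {x : Euc N} (hx : x ∈ Ω)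
    {Y : Matrix (Fin N) (Fin N) ℝ} (hY : Y.IsSymm)
    (h : ∀ ε > 0, ∃ φ : Euc N → ℝ, ContDiff ℝ 2 φ ∧ v x = φ x ∧
        IsLocalMinOn (fun x => v x - φ x) (closure Ω) x ∧
        hessianMatrix φ x = Y - (ε : ℝ) • 1) : F x Y ≤ b x := by
  refine le_of_forall_pos_le_add fun δ hδ => ?_
  have hLam : 0 < Lam := hF1.1.trans_le hF1.2.1
  obtain ⟨φ, hφ, hφx, hmin, hH⟩ := h (δ / (Lam * (N + 1))) (by positivity)
  have h1 := hsup x hx φ hφ hφx (hmin.on_subset subset_closure)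
  have h2 := (hF1.2.2 x hx (Y - (δ / (Lam * (N + 1))) • 1) ((δ / (Lam * (N + 1))) • 1)
    (hY.sub (Matrix.isSymm_one.smul _)) (Matrix.PosSemidef.one.smul (by positivity))).2
  rw [Matrix.trace_smul, Matrix.trace_one, Fintype.card_fin, smul_eq_mul, sub_add_cancel] at h2
  have h3 : Lam * (δ / (Lam * (N + 1)) * N) ≤ δ := by
    rw [← mul_assoc, mul_div_assoc', mul_div_mul_left _ _ hLam.ne', div_mul_eq_mul_div,
      div_le_iff₀ (by positivity)]
    nlinarith
  simp only [hH] at h1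
  linarith

/-- Comparison at an interior contact point of a subsolution and a supersolution. -/
theorem exists_contact_point_le {Ω : Set (Euc N)} (hΩo : IsOpen Ω) (hΩb : IsBounded Ω)
    {F : Euc N → Matrix (Fin N) (Fin N) ℝ → ℝ} {lam Lam : ℝ} (hF1 : IsF1 Ω F lam Lam)
    (hF3 : IsF3 Ω F) {u v a b : Euc N → ℝ} (hu : ContinuousOn u (closure Ω))
    (hv : ContinuousOn v (closure Ω)) (ha : ContinuousOn a Ω) (hb : ContinuousOn b Ω)
    (hsub : ViscSubsol Ω (fun x _ M => F x M - a x) u)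
    (hsup : ViscSupersol Ω (fun x _ M => F x M - b x) v)
    (hle : ∀ x ∈ closure Ω, u x ≤ v x) (hlt : ∀ x ∈ frontier Ω, u x < v x)
    (heq : ∃ x ∈ closure Ω, u x = v x) : ∃ x ∈ Ω, u x = v x ∧ a x ≤ b x := by
  obtain ⟨ω, -, hω0, hωc, -, hω⟩ := hF3
  obtain ⟨xe, hxe, hxeq⟩ := heq
  have hC : IsCompact (closure Ω) := hΩb.isCompact_closure
  have key := fun n : ℕ => exists_testFunctions hC ⟨xe, hxe⟩ hu hv
    (Nat.cast_add_one_pos (α := ℝ) n) (Nat.one_div_pos_of_nat (α := ℝ) (n := n))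
  choose x hx y hy X Y hX hY hL hU hi hux hvy using key
  obtain ⟨⟨x', y'⟩, ⟨hx', hy'⟩, ν, hν, hlim⟩ :=
    (hC.prod hC).tendsto_subseq (x := fun n => (x n, y n)) fun n => ⟨hx n, hy n⟩
  have hxl : Filter.Tendsto (fun n => x (ν n)) Filter.atTop (𝓝 x') :=
    (continuous_fst.tendsto _).comp hlim
  have hyl : Filter.Tendsto (fun n => y (ν n)) Filter.atTop (𝓝 y') :=
    (continuous_snd.tendsto _).comp hlim
  have hul : Filter.Tendsto (fun n => u (x (ν n))) Filter.atTop (𝓝 (u x')) :=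
    (hu x' hx').tendsto.comp (tendsto_nhdsWithin_iff.2 ⟨hxl, .of_forall fun n => hx _⟩)
  have hvl : Filter.Tendsto (fun n => v (y (ν n))) Filter.atTop (𝓝 (v y')) :=
    (hv y' hy').tendsto.comp (tendsto_nhdsWithin_iff.2 ⟨hyl, .of_forall fun n => hy _⟩)
  have hη : Filter.Tendsto (fun n => 1 / ((ν n : ℝ) + 1)) Filter.atTop (𝓝 0) :=
    tendsto_one_div_add_atTop_nhds_zero_nat.comp hν.tendsto_atTop
  have hs : Filter.Tendsto (fun n => u (x (ν n)) - v (y (ν n)) + 1 / ((ν n : ℝ) + 1))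
      Filter.atTop (𝓝 (u x' - v y')) := by
    simpa using (hul.sub hvl).add hη
  have hb1 : ∀ n, ((ν n : ℝ) + 1) * ‖x (ν n) - y (ν n)‖ ^ 2 ≤
      2 * (u (x (ν n)) - v (y (ν n)) + 1 / ((ν n : ℝ) + 1)) := fun n => by
    have := hi (ν n) xe hxe
    linarith
  have hb2 : ∀ n, ‖x (ν n) - y (ν n)‖ ^ 2 ≤
      1 / ((ν n : ℝ) + 1) * (2 * (u (x (ν n)) - v (y (ν n)) + 1 / ((ν n : ℝ) + 1))) :=
    fun n => by
      rw [one_div_mul_eq_div, le_div_iff₀ (by positivity), mul_comm]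
      exact hb1 n
  have hd2 : Filter.Tendsto (fun n => ‖x (ν n) - y (ν n)‖ ^ 2) Filter.atTop (𝓝 0) := by
    refine squeeze_zero (fun n => by positivity) hb2 ?_
    simpa using hη.mul (hs.const_mul 2)
  have hd : Filter.Tendsto (fun n => ‖x (ν n) - y (ν n)‖) Filter.atTop (𝓝 ‖x' - y'‖) :=
    (hxl.sub hyl).norm
  obtain rfl : x' = y' := by
    have := tendsto_nhds_unique (hd.pow 2) hd2
    exact sub_eq_zero.1 (norm_eq_zero.1 (pow_eq_zero_iff two_ne_zero |>.1 this))
  rw [sub_self, norm_zero] at hd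
  have h0 : 0 ≤ u x' - v x' := by
    refine ge_of_tendsto' hs fun n => ?_
    have h1 := hb1 n
    have h2 : 0 ≤ ((ν n : ℝ) + 1) * ‖x (ν n) - y (ν n)‖ ^ 2 := by positivity
    linarith
  have huv : u x' = v x' := le_antisymm (hle x' hx') (sub_nonneg.1 h0)
  have hx'Ω : x' ∈ Ω := by
    rw [closure_eq_self_union_frontier] at hx'
    exact hx'.resolve_right fun h => (hlt x' h).ne huv
  refine ⟨x', hx'Ω, huv, ?_⟩
  have hαd : Filter.Tendsto (fun n => ((ν n : ℝ) + 1) * ‖x (ν n) - y (ν n)‖ ^ 2)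
      Filter.atTop (𝓝 0) := by
    refine squeeze_zero (fun n => by positivity) hb1 ?_
    have := hs.const_mul 2
    rwa [huv, sub_self, mul_zero] at this
  have hωl : Filter.Tendsto (fun n => ω (((ν n : ℝ) + 1) * ‖x (ν n) - y (ν n)‖ ^ 2 +
      ‖x (ν n) - y (ν n)‖)) Filter.atTop (𝓝 0) := by
    rw [← hω0]
    refine hωc.tendsto.comp ?_
    simpa using hαd.add hd
  have hal : Filter.Tendsto (fun n => a (x (ν n))) Filter.atTop (𝓝 (a x')) :=
    ((ha.continuousAt (hΩo.mem_nhds hx'Ω)).tendsto).comp hxl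
  have hbl : Filter.Tendsto (fun n => b (y (ν n))) Filter.atTop (𝓝 (b x')) :=
    ((hb.continuousAt (hΩo.mem_nhds hx'Ω)).tendsto).comp hyl
  refine sub_nonpos.1 (le_of_tendsto_of_tendsto (hal.sub hbl) hωl ?_)
  filter_upwards [hxl (hΩo.mem_nhds hx'Ω), hyl (hΩo.mem_nhds hx'Ω)] with n hxn hyn
  have h1 := le_of_testFunctions_above hF1 hsub hxn (hX _) (hux (ν n))
  have h2 := le_of_testFunctions_below hF1 hsup hyn (hY _) (hvy (ν n))
  have h3 := hω _ (Nat.cast_add_one_pos (ν n)) _ hxn _ hyn _ _ (hX _) (hY _) (hL _) (hU _)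
  linarith

end Comparison

section Barrier

variable {N : ℕ}

theorem hessianMatrix_two_sub_exp {f : Euc N → ℝ} (hf : ContDiff ℝ 2 f) (K : ℝ) (x : Euc N) :
    hessianMatrix (fun x => 2 - Real.exp (K * f x)) x =
      bilinMatrix ((-(K * Real.exp (K * f x))) • (fderiv ℝ (fderiv ℝ f) x +
        K • (fderiv ℝ f x).smulRight (fderiv ℝ f x))) := by
  have hfd : ∀ x, HasFDerivAt f (fderiv ℝ f x) x :=
    fun x => (hf.differentiable two_ne_zero x).hasFDerivAt
  have he : ∀ x, HasFDerivAt (fun x => Real.exp (K * f x))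
      (Real.exp (K * f x) • (K • fderiv ℝ f x)) x := fun x => ((hfd x).const_mul K).exp
  refine hessianMatrix_eq_of_hasFDerivAt
    (φ' := fun x => (-(K * Real.exp (K * f x))) • fderiv ℝ f x) (fun x => ?_) ?_
  · refine ((he x).const_sub 2).congr_fderiv ?_
    ext v
    simp
    ring
  · refine (((he x).const_mul K).neg.smul (hasFDerivAt_fderiv hf x)).congr_fderiv ?_
    ext v w
    simp
    ring

theorem ellipticity_barrier_le {Ω : Set (Euc N)} {F : Euc N → Matrix (Fin N) (Fin N) ℝ → ℝ}
    {lam Lam : ℝ} (hF1 : IsF1 Ω F lam Lam) {f : Euc N → ℝ} (hf : ContDiff ℝ 2 f) {y : Euc N}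
    (hy : y ∈ Ω) {C K t : ℝ} (hC : ‖fderiv ℝ (fderiv ℝ f) y‖ ≤ C) (hK : 0 ≤ K) (ht : 0 ≤ t)
    {A : Matrix (Fin N) (Fin N) ℝ} (hA : A.IsSymm) :
    F y (A + t • hessianMatrix (fun x => 2 - Real.exp (K * f x)) y) ≤
      F y A + t * (Real.exp (K * f y) * (K * (Lam * (C * N)) -
        lam * (K ^ 2 * ∑ i, (fderiv ℝ f y (EuclideanSpace.single i 1)) ^ 2))) := by
  have hC0 : 0 ≤ C := le_trans (norm_nonneg (fderiv ℝ (fderiv ℝ f) y)) hC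
  set D := fderiv ℝ f y with hD
  set H := fderiv ℝ (fderiv ℝ f) y with hH
  set e := Real.exp (K * f y) with he
  have he0 : 0 ≤ e := (Real.exp_pos _).le
  have hHc : ∀ v w, H v w = H w v := fderiv_fderiv_comm hf y
  have hin : ∀ v w : Euc N, innerBilin N v w = innerBilin N w v := fun v w => by
    rw [innerBilin_apply, innerBilin_apply, real_inner_comm]
  have hHC : ∀ v, 0 ≤ H v v + C * ‖v‖ ^ 2 := fun v => by
    have h1 : |H v v| ≤ C * ‖v‖ * ‖v‖ :=
      (H.le_opNorm₂ v v).trans (by gcongr)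
    nlinarith [(abs_le.1 h1).1]
  have hs : 0 ≤ t * (K * e) := by positivity
  set Q : Euc N →L[ℝ] Euc N →L[ℝ] ℝ := (t * (K * e)) • ((H + C • innerBilin N) +
    K • D.smulRight D) with hQ
  have hQc : ∀ v w, Q v w = Q w v := fun v w => by
    simp [hQ, hHc v w, hin v w, mul_comm (D v)]
  have hQs : ∀ v, Q v v = t * (K * e) * (H v v + C * ‖v‖ ^ 2 + K * (D v) ^ 2) := fun v => by
    simp [hQ, innerBilin_self, pow_two]
    ring
  have hQ0 : ∀ v, 0 ≤ Q v v := fun v => by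
    rw [hQs]
    have := hHC v
    positivity
  have h1 := (hF1.2.2 y hy (A - bilinMatrix Q) ((t * (K * e) * C) • 1)
    (hA.sub (bilinMatrix_isSymm hQc)) (Matrix.PosSemidef.one.smul (by positivity))).2
  have h2 := (hF1.2.2 y hy (A - bilinMatrix Q) (bilinMatrix Q)
    (hA.sub (bilinMatrix_isSymm hQc)) (bilinMatrix_posSemidef hQc hQ0)).1
  have htr : t * (K * e) * (K * ∑ i, (D (EuclideanSpace.single i 1)) ^ 2) ≤
      (bilinMatrix Q).trace := by
    rw [Finset.mul_sum, Finset.mul_sum, Matrix.trace]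
    refine Finset.sum_le_sum fun i _ => ?_
    change _ ≤ Q (EuclideanSpace.single i 1) (EuclideanSpace.single i 1)
    rw [hQs]
    refine mul_le_mul_of_nonneg_left ?_ hs
    linarith [hHC (EuclideanSpace.single i 1)]
  have hm : A + t • hessianMatrix (fun x => 2 - Real.exp (K * f x)) y =
      A - bilinMatrix Q + (t * (K * e) * C) • 1 := by
    rw [hessianMatrix_two_sub_exp hf, ← bilinMatrix_innerBilin, ← bilinMatrix_smul,
      ← bilinMatrix_smul, sub_add, ← bilinMatrix_sub, sub_eq_add_neg]
    congr 1
    ext i j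
    set v : Euc N := EuclideanSpace.single i 1
    set w : Euc N := EuclideanSpace.single j 1
    change t * (-(K * e) * (H v w + K * (D v * D w))) = -(t * (K * e) *
      (H v w + C * innerBilin N v w + K * (D v * D w)) - t * (K * e) * C * innerBilin N v w)
    ring
  have htr' := mul_le_mul_of_nonneg_left htr hF1.1.le
  rw [Matrix.trace_smul, Matrix.trace_one, Fintype.card_fin, smul_eq_mul] at h1
  rw [sub_add_cancel] at h2
  rw [hm]
  nlinarith

theorem exists_barrier {Ω : Set (Euc N)} (hΩ : IsC2Domain Ω)
    {F : Euc N → Matrix (Fin N) (Fin N) ℝ → ℝ} {lam Lam : ℝ} (hF1 : IsF1 Ω F lam Lam) {c : ℝ}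
    (hc : 0 ≤ c) :
    ∃ h β : Euc N → ℝ, ContDiff ℝ 2 h ∧ Continuous β ∧ (∀ x ∈ closure Ω, 1 ≤ h x ∧ h x ≤ 2) ∧
      (∃ b, 0 ≤ b ∧ ∀ x ∈ Ω, β x ≤ b) ∧
      (∃ S ⊆ Ω, IsCompact S ∧ ∀ x ∈ Ω \ S, β x ≤ -c) ∧
      ∀ y ∈ Ω, ∀ t : ℝ, 0 ≤ t → ∀ A : Matrix (Fin N) (Fin N) ℝ, A.IsSymm →
        F y (A + t • hessianMatrix h y) ≤ F y A + t * β y := by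
  obtain ⟨hΩo, hΩb, hΩn, -, f, hf, hΩf, hfr, hgrad⟩ := hΩ
  have hlam : 0 < lam := hF1.1
  have hLam : 0 < Lam := hlam.trans_le hF1.2.1
  have hC : IsCompact (closure Ω) := hΩb.isCompact_closure
  have hfc : Continuous f := hf.continuous
  have hf1 : ContDiff ℝ 1 (fderiv ℝ f) := hf.fderiv_right (by norm_num)
  have hf2 : Continuous (fderiv ℝ (fderiv ℝ f)) := hf1.continuous_fderiv one_ne_zero
  have hfle : ∀ x ∈ closure Ω, f x ≤ 0 := by
    have : closure Ω ⊆ {x | f x ≤ 0} := by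
      refine closure_minimal ?_ (isClosed_le hfc continuous_const)
      rw [hΩf]
      exact fun x (hx : f x < 0) => hx.le
    exact this
  obtain ⟨C, hC0, hCb⟩ : ∃ C, 0 ≤ C ∧ ∀ x ∈ closure Ω, ‖fderiv ℝ (fderiv ℝ f) x‖ ≤ C := by
    obtain ⟨C, hC'⟩ := hC.exists_bound_of_continuousOn
      (Continuous.norm (E := Euc N →L[ℝ] Euc N →L[ℝ] ℝ) hf2).continuousOn
    simp only [norm_norm] at hC'
    exact ⟨C, le_trans (norm_nonneg (fderiv ℝ (fderiv ℝ f) hΩn.some))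
      (hC' _ (subset_closure hΩn.some_mem)), hC'⟩
  set g : Euc N → ℝ := fun x => ∑ i, (fderiv ℝ f x (EuclideanSpace.single i 1)) ^ 2 with hg
  have hgc : Continuous g := by
    have := hf1.continuous
    fun_prop
  have hg0 : ∀ x, 0 ≤ g x := fun x => Finset.sum_nonneg fun i _ => sq_nonneg _
  have hpos : ∀ x ∈ closure Ω, 0 < max (-f x) (g x) := by
    intro x hx
    rcases (hfle x hx).lt_or_eq with h | h
    · exact lt_max_of_lt_left (by linarith)
    · refine lt_max_of_lt_right ((hg0 x).lt_of_ne' fun h0 => ?_)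
      refine hgrad x (by rw [hfr]; exact h) ?_
      rw [Finset.sum_eq_zero_iff_of_nonneg fun i _ => sq_nonneg _] at h0
      refine ContinuousLinearMap.coe_injective
        ((EuclideanSpace.basisFun (Fin N) ℝ).toBasis.ext fun i => ?_)
      simpa using h0 i (Finset.mem_univ i)
  obtain ⟨z, hz, hzmin⟩ := hC.exists_isMinOn hΩn.closure
    (f := fun x => max (-f x) (g x)) (by fun_prop)
  obtain ⟨m, hm, hmle⟩ : ∃ m > 0, ∀ x ∈ closure Ω, m ≤ max (-f x) (g x) :=
    ⟨_, hpos z hz, fun x hx => hzmin hx⟩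
  set K : ℝ := 1 + 1 / m + (Lam * (C * N) + c * Real.exp 1) / (lam * m) with hK
  have hK1 : 1 ≤ K := by
    have : 0 ≤ 1 / m + (Lam * (C * N) + c * Real.exp 1) / (lam * m) := by positivity
    linarith
  have hKm : 1 / K < m := by
    rw [div_lt_comm₀ (by positivity) hm]
    have : 0 ≤ (Lam * (C * N) + c * Real.exp 1) / (lam * m) := by positivity
    linarith
  have hKl : Lam * (C * N) + c * Real.exp 1 ≤ lam * m * K := by
    rw [← div_le_iff₀' (by positivity)]
    have : 0 ≤ 1 / m := by positivity
    linarith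
  have hfΩ : ∀ x ∈ Ω, f x < 0 := fun x hx => by rwa [hΩf] at hx
  have hexp : ∀ x ∈ closure Ω, Real.exp (K * f x) ≤ 1 := fun x hx =>
    Real.exp_le_one_iff.2 (mul_nonpos_of_nonneg_of_nonpos (by linarith) (hfle x hx))
  refine ⟨fun x => 2 - Real.exp (K * f x), fun x => Real.exp (K * f x) *
    (K * (Lam * (C * N)) - lam * (K ^ 2 * g x)), by fun_prop, by fun_prop, ?_,
    ⟨K * (Lam * (C * N)), by positivity, ?_⟩,
    ⟨closure Ω ∩ {x | f x ≤ -(1 / K)}, ?_, ?_, ?_⟩, ?_⟩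
  · intro x hx
    have h1 := hexp x hx
    have h2 := Real.exp_pos (K * f x)
    exact ⟨by linarith, by linarith⟩
  · intro x hx
    have h1 := hexp x (subset_closure hx)
    have h2 := Real.exp_pos (K * f x)
    have h3 : 0 ≤ lam * (K ^ 2 * g x) := by
      have := hg0 x
      positivity
    have h4 : 0 ≤ K * (Lam * (C * N)) := by positivity
    nlinarith [mul_le_mul_of_nonneg_right h1 h4]
  · rintro x ⟨-, hx : f x ≤ -(1 / K)⟩
    rw [hΩf]
    have : 0 < 1 / K := by positivity
    exact hx.trans_lt (by linarith)
  · exact hC.inter_right (isClosed_le hfc continuous_const)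
  · rintro x ⟨hx, hxS⟩
    have hfx : -(1 / K) < f x := by
      by_contra! h
      exact hxS ⟨subset_closure hx, h⟩
    have hgm : m ≤ g x := by
      rcases le_max_iff.1 (hmle x (subset_closure hx)) with h | h
      · linarith
      · exact h
    have he : Real.exp (-1) ≤ Real.exp (K * f x) := by
      refine Real.exp_le_exp.2 ?_
      have := mul_lt_mul_of_pos_left hfx (show 0 < K by linarith)
      have e : K * -(1 / K) = -1 := by field_simp
      linarith
    have h1 : K * (Lam * (C * N)) - lam * (K ^ 2 * g x) ≤ -(c * Real.exp 1) := by
      have h2 : lam * (K ^ 2 * m) ≤ lam * (K ^ 2 * g x) := by gcongr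
      have h3 := mul_le_mul_of_nonneg_left hKl (show 0 ≤ K by linarith)
      have h4 : c * Real.exp 1 ≤ K * (c * Real.exp 1) :=
        le_mul_of_one_le_left (by positivity) hK1
      nlinarith
    have h5 : c * Real.exp 1 * Real.exp (-1) = c := by
      rw [mul_assoc, ← Real.exp_add]; simp
    have h6 : 0 ≤ c * Real.exp 1 := by positivity
    have h7 := mul_le_mul_of_nonneg_left h1 (Real.exp_pos (K * f x)).le
    have h8 := mul_le_mul_of_nonneg_left he h6
    linarith
  · intro y hy t ht A hA
    exact ellipticity_barrier_le hF1 hf hy (hCb y (subset_closure hy)) (by linarith) ht hA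

end Barrier

section Monotonicity

variable {N : ℕ}

theorem ViscSupersol.smul_add_barrier {Ω : Set (Euc N)}
    {F : Euc N → Matrix (Fin N) (Fin N) ℝ → ℝ} (hF2 : IsF2 Ω F) {μ p τ ε : ℝ}
    {k u h β : Euc N → ℝ} (hu : ViscSupersol Ω (logisticG F μ k p) u) (hh : ContDiff ℝ 2 h)
    (hβ : ∀ y ∈ Ω, ∀ t : ℝ, 0 ≤ t → ∀ A : Matrix (Fin N) (Fin N) ℝ, A.IsSymm →
        F y (A + t • hessianMatrix h y) ≤ F y A + t * β y) (hτ : 0 < τ) (hε : 0 ≤ ε) :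
    ViscSupersol Ω (fun x _ M => F x M - τ * (-(μ * u x) + k x * u x ^ p + ε * β x))
      (fun x => τ * (u x + ε * h x)) := by
  intro x₀ hx₀ ψ hψ hx hmin
  have hφ : ContDiff ℝ 2 fun x => τ⁻¹ * ψ x - ε * h x := by fun_prop
  have hmin' : IsLocalMinOn (fun x => u x - (τ⁻¹ * ψ x - ε * h x)) Ω x₀ := by
    have e : ∀ x, u x - (τ⁻¹ * ψ x - ε * h x) = τ⁻¹ * (τ * (u x + ε * h x) - ψ x) := fun x => by
      field_simp
      ring
    simp only [e]
    filter_upwards [hmin] with x hx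
    exact mul_le_mul_of_nonneg_left hx (inv_nonneg.2 hτ.le)
  have h1 := hu x₀ hx₀ _ hφ (by rw [← hx]; field_simp; ring) hmin'
  have h2 := hβ x₀ hx₀ ε hε _ (hessianMatrix_isSymm hφ x₀)
  simp only [logisticG, Real.rpow_eq_pow] at h1
  rw [hessianMatrix_smul_sub_smul hψ hh, sub_add_cancel,
    hF2 x₀ hx₀ _ (inv_nonneg.2 hτ.le), inv_mul_le_iff₀ hτ] at h2
  rw [hessianMatrix_smul_sub_smul hψ hh] at h1
  nlinarith [mul_le_mul_of_nonneg_left h1 hτ.le]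

theorem exists_rpow_close_to_one {p K δ : ℝ} (hδ : 0 < δ) :
    ∃ θ : ℝ, 0 < θ ∧ θ < 1 ∧ K * (1 - θ ^ p) ≤ δ := by
  have hc : ContinuousAt (fun θ : ℝ => K * (1 - θ ^ p)) 1 :=
    continuousAt_const.mul (continuousAt_const.sub
      (Real.continuousAt_rpow_const 1 p (Or.inl one_ne_zero)))
  have h1 : ∀ᶠ θ in 𝓝[<] (1 : ℝ), K * (1 - θ ^ p) < δ :=
    nhdsWithin_le_nhds (hc.eventually (gt_mem_nhds (by simpa using hδ)))
  have h2 : ∀ᶠ θ in 𝓝[<] (1 : ℝ), 0 < θ :=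
    nhdsWithin_le_nhds (lt_mem_nhds one_pos)
  obtain ⟨θ, h1, h2, h3⟩ := (h1.and (h2.and self_mem_nhdsWithin)).exists
  exact ⟨θ, h2, h3, h1.le⟩

/-- The scaled and perturbed larger-parameter solution dominates the smaller-parameter one. -/
theorem le_smul_add_barrier {Ω : Set (Euc N)} (hΩo : IsOpen Ω) (hΩb : IsBounded Ω)
    {F : Euc N → Matrix (Fin N) (Fin N) ℝ → ℝ} {lam Lam p : ℝ} {k : Euc N → ℝ}
    {k₁ μ₁ μ₂ M θ ε : ℝ} {u₁ u₂ h β : Euc N → ℝ}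
    (hF1 : IsF1 Ω F lam Lam) (hF2 : IsF2 Ω F) (hF3 : IsF3 Ω F) (hp : 1 < p)
    (hk_cont : ContinuousOn k Ω) (hk_bdd : ∀ x ∈ Ω, 0 ≤ k x ∧ k x ≤ k₁)
    (hu₁ : IsSolP1 Ω F μ₁ k p u₁) (hu₂ : IsSolP1 Ω F μ₂ k p u₂)
    (hM : ∀ x ∈ Ω, u₂ x ≤ M) (hθ : 0 < θ) (hθ1 : θ < 1)
    (hθM : k₁ * M ^ (p - 1) * (1 - θ ^ (p - 1)) ≤ (μ₂ - μ₁) / 2)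
    (hh : ContDiff ℝ 2 h) (hβc : Continuous β) (hh1 : ∀ x ∈ closure Ω, 1 ≤ h x)
    (hβ : ∀ y ∈ Ω, ∀ t : ℝ, 0 ≤ t → ∀ A : Matrix (Fin N) (Fin N) ℝ, A.IsSymm →
        F y (A + t • hessianMatrix h y) ≤ F y A + t * β y) (hε : 0 < ε)
    (hsmall : ∀ x ∈ Ω, ε * (μ₁ * h x + β x) < (μ₂ - μ₁) / 2 * u₂ x) :
    ∀ x ∈ Ω, u₁ x ≤ θ * (u₂ x + ε * h x) := by
  obtain ⟨hc₁, hpos₁, hsub, -, hbd₁⟩ := hu₁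
  obtain ⟨hc₂, hpos₂, -, hsup, hbd₂⟩ := hu₂
  intro x hx
  by_contra! hlt
  have hw : ∀ y ∈ closure Ω, 0 < u₂ y + ε * h y := by
    intro y hy
    have h1 : 0 < ε * h y := mul_pos hε (one_pos.trans_le (hh1 y hy))
    rw [closure_eq_self_union_frontier] at hy
    rcases hy with hy | hy
    · linarith [hpos₂ y hy]
    · linarith [hbd₂ y hy]
  have hwc : ContinuousOn (fun y => u₂ y + ε * h y) (closure Ω) :=
    hc₂.add (hh.continuous.const_mul ε).continuousOn
  obtain ⟨z, hz, hzmax⟩ := hΩb.isCompact_closure.exists_isMaxOn ⟨x, subset_closure hx⟩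
    (hc₁.div hwc fun y hy => (hw y hy).ne')
  set τ := u₁ z / (u₂ z + ε * h z) with hτ
  have hle : ∀ y ∈ closure Ω, u₁ y ≤ τ * (u₂ y + ε * h y) := fun y hy =>
    (div_le_iff₀ (hw y hy)).1 (hzmax hy)
  have hθτ : θ < τ :=
    ((lt_div_iff₀ (hw x (subset_closure hx))).2 hlt).trans_le (hzmax (subset_closure hx))
  have hτ0 : 0 < τ := hθ.trans hθτ
  have hrc : ∀ {u : Euc N → ℝ}, ContinuousOn u (closure Ω) → ContinuousOn (fun x => u x ^ p) Ω :=
    fun hu => (hu.mono subset_closure).rpow_const fun _ _ => Or.inr (by linarith)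
  obtain ⟨y, hy, hyeq, hab⟩ := exists_contact_point_le hΩo hΩb hF1 hF3
    (u := u₁) (v := fun x => τ * (u₂ x + ε * h x)) (a := fun x => -(μ₁ * u₁ x) + k x * u₁ x ^ p)
    (b := fun x => τ * (-(μ₂ * u₂ x) + k x * u₂ x ^ p + ε * β x)) hc₁
    (continuousOn_const.mul hwc)
    ((continuousOn_const.mul (hc₁.mono subset_closure)).neg.add (hk_cont.mul (hrc hc₁)))
    (continuousOn_const.mul (((continuousOn_const.mul (hc₂.mono subset_closure)).neg.add
      (hk_cont.mul (hrc hc₂))).add (hβc.const_mul ε).continuousOn))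
    (fun x₀ hx₀ φ hφ hx hmax => by
      have := hsub x₀ hx₀ φ hφ hx hmax
      simp only [logisticG, Real.rpow_eq_pow] at this
      linarith)
    (hsup.smul_add_barrier hF2 hh hβ hτ0 hε.le) hle
    (fun y hy => by
      rw [hbd₁ y hy]
      exact mul_pos hτ0 (hw y (frontier_subset_closure hy)))
    ⟨z, hz, (div_mul_cancel₀ _ (hw z hz).ne').symm⟩
  simp only [hyeq] at hab
  have h2 := hpos₂ y hy
  have hwy := hw y (subset_closure hy)
  have hp1 : p = p - 1 + 1 := by ring
  have e1 : u₂ y ^ p = u₂ y ^ (p - 1) * u₂ y := by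
    conv_lhs => rw [hp1]
    exact Real.rpow_add_one h2.ne' _
  have e2 : (τ * (u₂ y + ε * h y)) ^ p = τ * (τ ^ (p - 1) * (u₂ y + ε * h y) ^ p) := by
    rw [Real.mul_rpow hτ0.le hwy.le]
    conv_lhs => rw [hp1, Real.rpow_add_one hτ0.ne']
    rw [← hp1]
    ring
  have g1 : θ ^ (p - 1) * u₂ y ^ p ≤ τ ^ (p - 1) * (u₂ y + ε * h y) ^ p := by
    have h3 : θ ^ (p - 1) ≤ τ ^ (p - 1) := Real.rpow_le_rpow hθ.le hθτ.le (by linarith)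
    have h4 : u₂ y ^ p ≤ (u₂ y + ε * h y) ^ p := by
      refine Real.rpow_le_rpow h2.le ?_ (by linarith)
      have := mul_pos hε (one_pos.trans_le (hh1 y (subset_closure hy)))
      linarith
    gcongr
  have hθp : θ ^ (p - 1) ≤ 1 := Real.rpow_le_one hθ.le hθ1.le (by linarith)
  have g2 : k y * u₂ y ^ (p - 1) ≤ k₁ * M ^ (p - 1) := by
    have h3 : u₂ y ^ (p - 1) ≤ M ^ (p - 1) :=
      Real.rpow_le_rpow h2.le (hM y hy) (by linarith)
    have h4 := hk_bdd y hy
    exact mul_le_mul h4.2 h3 (Real.rpow_nonneg h2.le _) (h4.1.trans h4.2)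
  have g3 : k y * u₂ y ^ p * (1 - θ ^ (p - 1)) ≤ (μ₂ - μ₁) / 2 * u₂ y := by
    calc k y * u₂ y ^ p * (1 - θ ^ (p - 1))
        = k y * u₂ y ^ (p - 1) * (1 - θ ^ (p - 1)) * u₂ y := by rw [e1]; ring
      _ ≤ k₁ * M ^ (p - 1) * (1 - θ ^ (p - 1)) * u₂ y := by
        have := sub_nonneg.2 hθp
        gcongr
      _ ≤ _ := by gcongr
  have g4 := mul_le_mul_of_nonneg_left g1 (hk_bdd y hy).1
  rw [e2] at hab
  have hab' : -(μ₁ * (u₂ y + ε * h y)) + k y * (τ ^ (p - 1) * (u₂ y + ε * h y) ^ p) ≤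
      -(μ₂ * u₂ y) + k y * u₂ y ^ p + ε * β y := by
    refine le_of_mul_le_mul_left ?_ hτ0
    linarith
  have := hsmall y hy
  nlinarith

end Monotonicity

/-- monotonicity in `μ`: if `μ₁ < μ₂` and `u₁, u₂` are positive viscosity
solutions of problem (1) with parameters `μ₁, μ₂` respectively, then `u₁ < u₂` in `Ω`. -/
theorem statement13 {N : ℕ} (Ω : Set (Euc N))
    (F : Euc N → Matrix (Fin N) (Fin N) ℝ → ℝ) (lam Lam p : ℝ)
    (k : Euc N → ℝ) (k₁ μ₁ μ₂ : ℝ) (u₁ u₂ : Euc N → ℝ)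
    (hΩ : IsC2Domain Ω) (hFc : FCont Ω F)
    (hF1 : IsF1 Ω F lam Lam) (hF2 : IsF2 Ω F) (hF3 : IsF3 Ω F)
    (hp : 1 < p) (hk_cont : ContinuousOn k Ω)
    (hk_bdd : ∀ x ∈ Ω, 0 ≤ k x ∧ k x ≤ k₁) (hk_ne : ∃ x ∈ Ω, k x ≠ 0)
    (hμ : μ₁ < μ₂)
    (hu₁ : IsSolP1 Ω F μ₁ k p u₁) (hu₂ : IsSolP1 Ω F μ₂ k p u₂) :
    ∀ x ∈ Ω, u₁ x < u₂ x := by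
  have hd : 0 < (μ₂ - μ₁) / 2 := by linarith
  obtain ⟨M, hM⟩ : ∃ M, ∀ x ∈ closure Ω, u₂ x ≤ M := by
    obtain ⟨M, hM⟩ := hΩ.2.1.isCompact_closure.exists_bound_of_continuousOn hu₂.1
    exact ⟨M, fun x hx => (le_abs_self _).trans (hM x hx)⟩
  obtain ⟨θ, hθ, hθ1, hθM⟩ := exists_rpow_close_to_one (p := p - 1) (K := k₁ * M ^ (p - 1)) hd
  obtain ⟨h, β, hh, hβc, hh12, ⟨b, hb0, hb⟩, ⟨S, hSΩ, hS, hβS⟩, hβ⟩ :=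
    exists_barrier hΩ hF1 (c := 2 * |μ₁| + 1) (by positivity)
  obtain ⟨m, hm, hmS⟩ : ∃ m > 0, ∀ x ∈ S, m ≤ u₂ x := by
    rcases S.eq_empty_or_nonempty with rfl | hne
    · exact ⟨1, one_pos, by simp⟩
    · obtain ⟨z, hz, hzmin⟩ :=
        hS.exists_isMinOn hne (hu₂.1.mono (hSΩ.trans subset_closure))
      exact ⟨u₂ z, hu₂.2.1 z (hSΩ hz), fun x hx => hzmin hx⟩
  intro x hx
  have hux := hu₂.2.1 x hx
  set ε := min ((μ₂ - μ₁) / 2 * m / (2 * |μ₁| + b + 1)) ((1 - θ) * u₂ x / 4) with hεdef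
  have hε : 0 < ε := by
    have := sub_pos.2 hθ1
    positivity
  have hεm : ε * (2 * |μ₁| + b + 1) ≤ (μ₂ - μ₁) / 2 * m :=
    (le_div_iff₀ (by positivity)).1 (min_le_left _ _)
  have hεx : ε ≤ (1 - θ) * u₂ x / 4 := min_le_right _ _
  have hμh : ∀ y ∈ Ω, μ₁ * h y ≤ 2 * |μ₁| := fun y hy => by
    obtain ⟨h1, h2⟩ := hh12 y (subset_closure hy)
    nlinarith [le_abs_self μ₁, abs_nonneg μ₁]
  have hsmall : ∀ y ∈ Ω, ε * (μ₁ * h y + β y) < (μ₂ - μ₁) / 2 * u₂ y := by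
    intro y hy
    have h1 := hμh y hy
    by_cases hyS : y ∈ S
    · have h2 : μ₁ * h y + β y < 2 * |μ₁| + b + 1 := by linarith [hb y hy]
      have h3 := mul_lt_mul_of_pos_left h2 hε
      have h4 := mul_le_mul_of_nonneg_left (hmS y hyS) hd.le
      linarith
    · have h2 : μ₁ * h y + β y < 0 := by linarith [hβS y ⟨hy, hyS⟩]
      exact (mul_neg_of_pos_of_neg hε h2).trans (mul_pos hd (hu₂.2.1 y hy))
  have key := le_smul_add_barrier hΩ.1 hΩ.2.1 hF1 hF2 hF3 hp hk_cont hk_bdd hu₁ hu₂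
    (fun y hy => hM y (subset_closure hy)) hθ hθ1 hθM hh hβc (fun y hy => (hh12 y hy).1) hβ hε
    hsmall x hx
  have h2 : θ * (ε * h x) ≤ 2 * ε := by
    obtain ⟨h1, h2⟩ := hh12 x (subset_closure hx)
    have h3 : ε * h x ≤ ε * 2 := by gcongr
    have h4 : 0 ≤ ε * h x := by positivity
    nlinarith
  have h3 : 0 < (1 - θ) * u₂ x := mul_pos (by linarith) hux
  linarith
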